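/- Let G be a topological group and let 0 < p < q < ∞. For every continuous affine isometric action α of G on an L_p space L_p(X,μ), there exists a continuous affine isometric action β of G on an L_q space L_q(Y,ν) such that ‖α_g(0)‖_{L_p}^p = ‖β_g(0)‖_{L_q}^q for every g ∈ G. -/

import Mathlib

open MeasureTheory ENNReal

/-- The quantity `‖f‖_p^p = ∫ |f|^p dμ`, valued in `ℝ≥0∞`.  This is the natural way to
measure the size of an element of an `L_p` space for any `0 < p < ∞`. -/
noncomputable def pPow {X : Type*} [MeasurableSpace X] (μ : Measure X) (p : ℝ)
    (f : X →ₘ[μ] ℂ) : ℝ≥0∞ :=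
  ∫⁻ x, (‖f x‖₊ : ℝ≥0∞) ^ p ∂μ

/-- A continuous affine isometric action of a topological group `G` on `L_p(X,μ)`:
a group homomorphism from `G` to the group of surjective affine isometries of
`L_p(X,μ)`, such that `g ↦ α_g f` is continuous for every `f`.  (Surjectivity of each
`act g` is automatic from the group laws.)  Isometry is expressed via the quantity
`pPow μ p` (i.e. `‖·‖_p^p`), and continuity via convergence in `L_p`, which makes sense
for every `0 < p < ∞`, including `p < 1`. -/
structure AffineIsometricAction (G : Type*) [Group G] [TopologicalSpace G]
    {X : Type*} [MeasurableSpace X] (μ : Measure X) (p : ℝ) where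
  act : G → Lp ℂ (ENNReal.ofReal p) μ → Lp ℂ (ENNReal.ofReal p) μ
  act_one : ∀ f, act 1 f = f
  act_mul : ∀ g h f, act (g * h) f = act g (act h f)
  isometry : ∀ g f f',
    pPow μ p ((act g f : X →ₘ[μ] ℂ) - (act g f' : X →ₘ[μ] ℂ))
      = pPow μ p ((f : X →ₘ[μ] ℂ) - (f' : X →ₘ[μ] ℂ))
  affine : ∀ (g : G) (t : ℝ) (f f' : Lp ℂ (ENNReal.ofReal p) μ),
    act g (t • f + (1 - t) • f') = t • act g f + (1 - t) • act g f'
  continuous : ∀ (f : Lp ℂ (ENNReal.ofReal p) μ) (g₀ : G),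
    Filter.Tendsto (fun g => pPow μ p ((act g f : X →ₘ[μ] ℂ) - (act g₀ f : X →ₘ[μ] ℂ)))
      (nhds g₀) (nhds 0)

open MeasureTheory ENNReal

/-- `∫ |f|^p` for functions. -/
noncomputable def NN {X : Type*} [MeasurableSpace X] (μ : Measure X) (p : ℝ)
    (f : X → ℂ) : ℝ≥0∞ := ∫⁻ x, ‖f x‖ₑ ^ p ∂μ

section basics
variable {X : Type*} [MeasurableSpace X] {μ : Measure X} {p : ℝ}

lemma NN_congr {f g : X → ℂ} (h : f =ᵐ[μ] g) : NN μ p f = NN μ p g := by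
  unfold NN
  apply lintegral_congr_ae
  filter_upwards [h] with x hx
  rw [hx]

lemma rpow_add_le_two (hp : 0 < p) (a b : ℝ≥0∞) : (a + b) ^ p ≤ 2 ^ p * (a ^ p + b ^ p) := by
  rcases le_total a b with h | h
  · calc (a + b) ^ p ≤ (2 * b) ^ p := by
          apply ENNReal.rpow_le_rpow _ hp.le
          rw [two_mul]; gcongr
      _ = 2 ^ p * b ^ p := ENNReal.mul_rpow_of_nonneg _ _ hp.le
      _ ≤ _ := by gcongr; exact le_add_self
  · calc (a + b) ^ p ≤ (2 * a) ^ p := by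
          apply ENNReal.rpow_le_rpow _ hp.le
          rw [two_mul]; gcongr
      _ = 2 ^ p * a ^ p := ENNReal.mul_rpow_of_nonneg _ _ hp.le
      _ ≤ _ := by gcongr; exact le_self_add

lemma NN_mono_ae {f g : X → ℂ} (hp : 0 < p) (h : ∀ᵐ x ∂μ, ‖f x‖ₑ ≤ ‖g x‖ₑ) :
    NN μ p f ≤ NN μ p g := by
  apply lintegral_mono_ae
  filter_upwards [h] with x hx
  gcongr

lemma NN_add_le {f g : X → ℂ} (hp : 0 < p) (hf : AEStronglyMeasurable f μ) :
    NN μ p (f + g) ≤ 2 ^ p * (NN μ p f + NN μ p g) := by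
  unfold NN
  rw [← lintegral_add_left' (by fun_prop), ← lintegral_const_mul' _ _ (by
    exact ENNReal.rpow_ne_top_of_nonneg hp.le (by simp))]
  apply lintegral_mono
  intro x
  refine le_trans ?_ (rpow_add_le_two hp _ _)
  exact ENNReal.rpow_le_rpow (enorm_add_le _ _) hp.le

lemma NN_sub_comm (f g : X → ℂ) : NN μ p (f - g) = NN μ p (g - f) := by
  unfold NN
  congr 1; ext x
  simp only [Pi.sub_apply]
  rw [← enorm_neg, neg_sub]

lemma NN_sub_le {f g h : X → ℂ} (hp : 0 < p) (hf : AEStronglyMeasurable f μ)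
    (hg : AEStronglyMeasurable g μ) :
    NN μ p (f - h) ≤ 2 ^ p * (NN μ p (f - g) + NN μ p (g - h)) := by
  have : f - h = (f - g) + (g - h) := by abel
  rw [this]
  exact NN_add_le hp (hf.sub hg)

lemma NN_smul (hp : 0 < p) (c : ℂ) (f : X → ℂ) :
    NN μ p (fun x => c * f x) = ‖c‖ₑ ^ p * NN μ p f := by
  unfold NN
  rw [← lintegral_const_mul' _ _ (ENNReal.rpow_ne_top_of_nonneg hp.le (by simp))]
  congr 1; ext x
  rw [enorm_mul, ENNReal.mul_rpow_of_nonneg _ _ hp.le]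

lemma NN_eq_zero (hp : 0 < p) {f : X → ℂ} (hf : AEStronglyMeasurable f μ) :
    NN μ p f = 0 ↔ f =ᵐ[μ] 0 := by
  unfold NN
  rw [lintegral_eq_zero_iff' (by fun_prop)]
  constructor <;> intro h <;> filter_upwards [h] with x hx
  · simpa [hp, hp.not_gt] using hx
  · simp [hx, hp]

lemma memLp_iff_NN (hp : 0 < p) {f : X → ℂ} :
    MemLp f (ENNReal.ofReal p) μ ↔ AEStronglyMeasurable f μ ∧ NN μ p f < ⊤ := by
  have h0 : ENNReal.ofReal p ≠ 0 := by simpa using hp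
  unfold MemLp NN
  rw [eLpNorm_lt_top_iff_lintegral_rpow_enorm_lt_top h0 ENNReal.ofReal_ne_top,
    ENNReal.toReal_ofReal hp.le]

lemma NN_le_of_eLpNorm (hp : 0 < p) {f : X → ℂ} {ε : ℝ≥0∞}
    (h : eLpNorm f (ENNReal.ofReal p) μ ≤ ε) : NN μ p f ≤ ε ^ p := by
  have h0 : ENNReal.ofReal p ≠ 0 := by simpa using hp
  rw [eLpNorm_eq_lintegral_rpow_enorm_toReal h0 ENNReal.ofReal_ne_top, ENNReal.toReal_ofReal hp.le] at h
  have := ENNReal.rpow_le_rpow h hp.le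
  rwa [← ENNReal.rpow_mul, one_div, inv_mul_cancel₀ hp.ne', ENNReal.rpow_one] at this

lemma pPow_eq_NN (f : X →ₘ[μ] ℂ) : pPow μ p f = NN μ p f := rfl

lemma pPow_sub (f g : X →ₘ[μ] ℂ) : pPow μ p (f - g) = NN μ p (⇑f - ⇑g) := by
  rw [pPow_eq_NN]; exact NN_congr (AEEqFun.coeFn_sub f g)

end basics

/-- Surjective real-linear isometry of `L_p`. -/
structure LinIso {X : Type*} [MeasurableSpace X] (μ : Measure X) (p : ℝ)
    (T : Lp ℂ (ENNReal.ofReal p) μ → Lp ℂ (ENNReal.ofReal p) μ) : Prop where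
  add : ∀ f g, T (f + g) = T f + T g
  smul : ∀ (t : ℝ) f, T (t • f) = t • T f
  iso : ∀ f, NN μ p (T f) = NN μ p f

section linpart
variable {G : Type*} [Group G] [TopologicalSpace G]
  {X : Type*} [MeasurableSpace X] {μ : Measure X} {p : ℝ}

/-- linear part of the action -/
noncomputable def linPart (α : AffineIsometricAction G μ p) (g : G)
    (f : Lp ℂ (ENNReal.ofReal p) μ) : Lp ℂ (ENNReal.ofReal p) μ := α.act g f - α.act g 0

variable (α : AffineIsometricAction G μ p)

lemma linPart_smul (g : G) (t : ℝ) (f : Lp ℂ (ENNReal.ofReal p) μ) :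
    linPart α g (t • f) = t • linPart α g f := by
  have := α.affine g t f 0
  rw [smul_zero, add_zero] at this
  simp only [linPart]
  rw [this]
  module

lemma linPart_add (g : G) (f f' : Lp ℂ (ENNReal.ofReal p) μ) :
    linPart α g (f + f') = linPart α g f + linPart α g f' := by
  have h1 := α.affine g (1/2) ((2:ℝ) • f) ((2:ℝ) • f')
  have h2 := linPart_smul α g 2 f
  have h3 := linPart_smul α g 2 f'
  have e : (1/2 : ℝ) • (2:ℝ) • f + (1 - 1/2 : ℝ) • (2:ℝ) • f' = f + f' := by
    rw [smul_smul, smul_smul]; norm_num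
  rw [e] at h1
  simp only [linPart] at *
  rw [h1]
  rw [sub_eq_iff_eq_add] at h2 h3
  rw [h2, h3]
  module

lemma NN_sub_coe (f f' : Lp ℂ (ENNReal.ofReal p) μ) :
    NN μ p ⇑(f - f') = pPow μ p ((f : X →ₘ[μ] ℂ) - (f' : X →ₘ[μ] ℂ)) := by
  rfl

lemma linPart_isometry (g : G) (f : Lp ℂ (ENNReal.ofReal p) μ) :
    NN μ p (linPart α g f) = NN μ p f := by
  simp only [linPart]
  rw [NN_sub_coe, α.isometry, ← NN_sub_coe, sub_zero]

lemma linPart_linIso (g : G) : LinIso μ p (linPart α g) :=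
  ⟨linPart_add α g, linPart_smul α g, linPart_isometry α g⟩

lemma linPart_zero (g : G) : linPart α g 0 = 0 := by simp [linPart]

lemma linPart_sub (g : G) (f f' : Lp ℂ (ENNReal.ofReal p) μ) :
    linPart α g (f - f') = linPart α g f - linPart α g f' := by
  rw [eq_sub_iff_add_eq, ← linPart_add, sub_add_cancel]

lemma act_eq (g : G) (f : Lp ℂ (ENNReal.ofReal p) μ) :
    α.act g f = linPart α g f + α.act g 0 := by simp [linPart]

lemma linPart_mul (g h : G) (f : Lp ℂ (ENNReal.ofReal p) μ) :
    linPart α (g * h) f = linPart α g (linPart α h f) := by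
  have : linPart α g (linPart α h f) = linPart α g (α.act h f) - linPart α g (α.act h 0) := by
    rw [← linPart_sub]; rfl
  rw [this]
  simp only [linPart, α.act_mul]
  abel

lemma linPart_one (f : Lp ℂ (ENNReal.ofReal p) μ) : linPart α 1 f = f := by
  simp [linPart, α.act_one]

lemma act_mul_zero (g h : G) : α.act (g * h) 0 = linPart α g (α.act h 0) + α.act g 0 := by
  rw [α.act_mul, act_eq]

lemma act_tendsto (f : Lp ℂ (ENNReal.ofReal p) μ) (g₀ : G) :
    Filter.Tendsto (fun g => NN μ p ⇑(α.act g f - α.act g₀ f)) (nhds g₀) (nhds 0) :=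
  α.continuous f g₀

lemma linPart_tendsto (hp : 0 < p) (f : Lp ℂ (ENNReal.ofReal p) μ) (g₀ : G) :
    Filter.Tendsto (fun g => NN μ p ⇑(linPart α g f - linPart α g₀ f)) (nhds g₀) (nhds 0) := by
  have h1 := (act_tendsto α f g₀).add (act_tendsto α 0 g₀)
  have h2 := ENNReal.Tendsto.const_mul (a := (2:ℝ≥0∞)^p) h1
    (Or.inr (ENNReal.rpow_ne_top_of_nonneg hp.le (by simp)))
  simp only [add_zero, mul_zero] at h2
  refine tendsto_of_tendsto_of_tendsto_of_le_of_le tendsto_const_nhds h2 (fun _ => zero_le) ?_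
  intro g
  have e : linPart α g f - linPart α g₀ f
      = (α.act g f - α.act g₀ f) - (α.act g 0 - α.act g₀ 0) := by
    simp only [linPart]; abel
  show NN μ p ⇑(linPart α g f - linPart α g₀ f) ≤ _
  rw [e, NN_congr (Lp.coeFn_sub _ _), sub_eq_add_neg]
  refine (NN_add_le hp (Lp.aestronglyMeasurable _)).trans (le_of_eq ?_)
  congr 2
  unfold NN
  simp

end linpart

open MeasureTheory ENNReal

/-- The measure `|ξ|^{-2-p} dξ` on `ℂ`. -/
noncomputable def kap (p : ℝ) : Measure ℂ :=
  (volume : Measure ℂ).withDensity (fun ξ => ENNReal.ofReal (‖ξ‖ ^ (-2 - p)))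

instance (p : ℝ) : SigmaFinite (kap p) := by
  unfold kap
  exact SigmaFinite.withDensity_of_ne_top' (fun _ => ENNReal.ofReal_ne_top)

lemma lintegral_kap (p : ℝ) (Φ : ℂ → ℝ≥0∞) (hΦ : Measurable Φ) :
    ∫⁻ ξ, Φ ξ ∂(kap p) = ∫⁻ ξ : ℂ, ENNReal.ofReal (‖ξ‖ ^ (-2 - p)) * Φ ξ := by
  unfold kap
  rw [lintegral_withDensity_eq_lintegral_mul _ (by fun_prop) hΦ]
  rfl

lemma kap_ac (p : ℝ) : kap p ≪ volume := withDensity_absolutelyContinuous _ _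

lemma kap_ac' (p : ℝ) : (volume : Measure ℂ) ≪ kap p := by
  unfold kap
  apply withDensity_absolutelyContinuous' (by fun_prop)
  have : ∀ᵐ ξ : ℂ, ξ ≠ 0 := by
    simp [ae_iff]
  filter_upwards [this] with ξ hξ
  have : 0 < ‖ξ‖ := norm_pos_iff.mpr hξ
  have := Real.rpow_pos_of_pos this (-2-p)
  simpa using this

lemma lintegral_kap_similarity (p : ℝ) (L : ℂ →ₗ[ℝ] ℂ) (r : ℝ) (hr : 0 < r)
    (hL : ∀ ξ, ‖L ξ‖ = r * ‖ξ‖) (Φ : ℂ → ℝ≥0∞) (hΦ : Measurable Φ) :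
    ∫⁻ ξ, Φ (L ξ) ∂(kap p) = ENNReal.ofReal (r ^ p) * ∫⁻ ξ, Φ ξ ∂(kap p) := by
  let U0 : ℂ →ₗᵢ[ℝ] ℂ := ⟨r⁻¹ • L, fun ξ => by
    simp only [LinearMap.smul_apply, norm_smul, hL, norm_inv, Real.norm_eq_abs, abs_of_pos hr]
    field_simp⟩
  let U : ℂ ≃ₗᵢ[ℝ] ℂ := U0.toLinearIsometryEquiv rfl
  have hU : ∀ ξ, L ξ = r • U ξ := by
    intro ξ
    show L ξ = r • (r⁻¹ • L ξ)
    rw [smul_smul, mul_inv_cancel₀ hr.ne', one_smul]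
  have hLm : Measurable (fun ξ => L ξ) := by
    have : (fun ξ => L ξ) = fun ξ => r • U ξ := funext hU
    rw [this]
    exact (U.continuous.const_smul r).measurable
  rw [lintegral_kap _ (fun ξ => Φ (L ξ)) (hΦ.comp hLm), lintegral_kap _ _ hΦ]
  set Ψ : ℂ → ℝ≥0∞ := fun ξ => ENNReal.ofReal (‖ξ‖ ^ (-2 - p)) * Φ ξ with hΨ
  have hΨm : Measurable Ψ := by fun_prop
  have e1 : ∀ ξ : ℂ, ENNReal.ofReal (‖ξ‖ ^ (-2 - p)) * Φ (L ξ)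
      = ENNReal.ofReal (r ^ (2 + p)) * Ψ (r • U ξ) := by
    intro ξ
    simp only [hΨ]
    rw [← hU, hL, ← mul_assoc, ← ENNReal.ofReal_mul (by positivity),
      Real.mul_rpow hr.le (norm_nonneg _), ← mul_assoc, ← Real.rpow_add hr]
    norm_num
  simp_rw [e1]
  rw [lintegral_const_mul _ (by
    exact hΨm.comp ((U.continuous.const_smul r).measurable))]
  rw [(U.measurePreserving).lintegral_comp (f := fun ξ => Ψ (r • ξ)) (by fun_prop)]
  have h2 : ∫⁻ ξ : ℂ, Ψ (r • ξ) = ENNReal.ofReal (r ^ (-2 : ℝ)) * ∫⁻ ξ, Ψ ξ := by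
    have := Measure.map_addHaar_smul (volume : Measure ℂ) hr.ne'
    rw [← lintegral_map (f := Ψ) (g := fun ξ : ℂ => r • ξ) hΨm (by fun_prop), this,
      lintegral_smul_measure]
    simp only [smul_eq_mul]
    congr 2
    rw [Complex.finrank_real_complex, abs_of_pos (by positivity), Real.rpow_neg hr.le]
    norm_num
  rw [h2, ← mul_assoc, ← ENNReal.ofReal_mul (by positivity), ← Real.rpow_add hr]
  norm_num

/-- normalising constant -/
noncomputable def c0 (p q : ℝ) : ℝ≥0∞ :=
  ∫⁻ ξ : ℂ, ‖Complex.exp (Complex.I * (ξ.re : ℂ)) - 1‖ₑ ^ q ∂(kap p)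

lemma c0_ne_zero (p q : ℝ) (hp : 0 < p) (hq : p < q) : c0 p q ≠ 0 := by
  intro h
  unfold c0 at h
  rw [lintegral_eq_zero_iff (by fun_prop)] at h
  have h' := (kap_ac' p).ae_le h
  have hq0 : 0 < q := hp.trans hq
  have hopen : IsOpen {ξ : ℂ | 0 < ξ.re ∧ ξ.re < 1} :=
    (isOpen_lt continuous_const Complex.continuous_re).inter
      (isOpen_lt Complex.continuous_re continuous_const)
  have hpos := hopen.measure_pos volume ⟨(1/2 : ℝ), by
    simp only [Set.mem_ofPred_eq, Complex.ofReal_re]; norm_num⟩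
  apply hpos.ne'
  rw [← nonpos_iff_eq_zero, ← ae_iff.mp h']
  apply measure_mono
  rintro ξ ⟨h1, h2⟩
  simp only [Set.mem_ofPred_eq, Pi.zero_apply, ENNReal.rpow_eq_zero_iff, hq0, hq0.not_gt]
  simp only [enorm_eq_zero, and_true, and_false, or_false, sub_eq_zero]
  rw [Complex.exp_eq_one_iff]
  rintro ⟨n, hn⟩
  have : (ξ.re : ℂ) = ((n * (2 * Real.pi) : ℝ) : ℂ) := by
    have hI := Complex.I_ne_zero
    apply mul_left_cancel₀ hI
    rw [hn]; push_cast; ring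
  have h3 : ξ.re = n * (2 * Real.pi) := by exact_mod_cast this
  have hpi := Real.pi_gt_three
  have hn0 : (0:ℝ) < n := by
    by_contra hc
    push Not at hc
    nlinarith
  have : (1:ℝ) ≤ n := by exact_mod_cast (by exact_mod_cast hn0 : (0:ℤ) < n)
  nlinarith

lemma norm_exp_sub_one_le (t : ℝ) : ‖Complex.exp (Complex.I * (t : ℂ)) - 1‖ ≤ min 2 |t| := by
  apply le_min
  · calc _ ≤ ‖Complex.exp (Complex.I * (t : ℂ))‖ + ‖(1:ℂ)‖ := norm_sub_le _ _
      _ = 2 := by rw [Complex.norm_exp_I_mul_ofReal]; norm_num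
  · simpa using Real.norm_exp_I_mul_ofReal_sub_one_le (x := t)

lemma c0_ne_top (p q : ℝ) (hp : 0 < p) (hq : p < q) : c0 p q ≠ ⊤ := by
  have hq0 : 0 < q := hp.trans hq
  unfold c0
  rw [lintegral_kap _ _ (by fun_prop)]
  have h_integ : Integrable (fun ξ : ℂ => (fun y : ℝ => y ^ (-2 - p) * (min 2 y) ^ q) ‖ξ‖) volume := by
    refine (integrable_fun_norm_addHaar (E := ℂ) (F := ℝ) (volume : Measure ℂ)
      (f := fun y : ℝ => y ^ (-2 - p) * (min 2 y) ^ q)).mpr ?_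
    rw [Complex.finrank_real_complex]
    have : Set.Ioi (0:ℝ) = Set.Ioc 0 1 ∪ Set.Ioi 1 := by
      rw [Set.Ioc_union_Ioi_eq_Ioi]; norm_num
    rw [this]
    apply IntegrableOn.union
    · have h1 : IntegrableOn (fun y : ℝ => y ^ (q - p - 1)) (Set.Ioc 0 1) := by
        rw [← intervalIntegrable_iff_integrableOn_Ioc_of_le zero_le_one]
        apply intervalIntegral.intervalIntegrable_rpow'
        linarith
      refine h1.congr_fun ?_ measurableSet_Ioc
      intro y hy
      have hy0 : 0 < y := hy.1
      have hm : min 2 y = y := min_eq_right (by linarith [hy.2])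
      simp only [hm, smul_eq_mul]
      rw [← Real.rpow_add hy0, ← Real.rpow_natCast, ← Real.rpow_add hy0]
      congr 1; push_cast; ring
    · have h1 : IntegrableOn (fun y : ℝ => 2 ^ q * y ^ (-1 - p)) (Set.Ioi 1) :=
        (integrableOn_Ioi_rpow_of_lt (by linarith) zero_lt_one).const_mul _
      refine Integrable.mono' h1 (by fun_prop) ?_
      refine (ae_restrict_iff' measurableSet_Ioi).mpr (Filter.Eventually.of_forall ?_)
      intro y hy
      have hy1 : 1 < y := hy
      have hy0 : 0 < y := by linarith
      have hm0 : 0 < min 2 y := lt_min (by norm_num) hy0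
      rw [Real.norm_of_nonneg (by positivity), smul_eq_mul]
      have : y ^ (2 - 1) * (y ^ (-2 - p) * min 2 y ^ q) = (min 2 y) ^ q * y ^ (-1 - p) := by
        rw [show (-1 - p) = ((1:ℕ):ℝ) + (-2 - p) by push_cast; ring, Real.rpow_add hy0, Real.rpow_natCast]
        ring
      rw [this]
      gcongr
      exact min_le_left _ _
  have := h_integ.lintegral_lt_top
  refine (lt_of_le_of_lt ?_ this).ne
  apply lintegral_mono
  intro ξ
  simp only
  rw [ENNReal.ofReal_mul (by positivity), ← ENNReal.ofReal_rpow_of_nonneg (by positivity) hq0.le]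
  gcongr
  rw [← ofReal_norm]
  apply ENNReal.ofReal_le_ofReal
  refine (norm_exp_sub_one_le _).trans ?_
  gcongr
  exact Complex.abs_re_le_norm ξ

lemma lintegral_exp_kap (p q : ℝ) (hp : 0 < p) (hq : p < q) (a : ℂ) :
    ∫⁻ ξ : ℂ, ‖Complex.exp (Complex.I * (((starRingEnd ℂ ξ) * a).re : ℂ)) - 1‖ₑ ^ q ∂(kap p)
      = ‖a‖ₑ ^ p * c0 p q := by
  have hq0 : 0 < q := hp.trans hq
  by_cases ha : a = 0
  · simp [ha, hp, hq0]
  have ha' : 0 < ‖a‖ := norm_pos_iff.mpr ha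
  let L : ℂ →ₗ[ℝ] ℂ := (LinearMap.mulRight ℝ (starRingEnd ℂ a))
  have hL : ∀ ξ, ‖L ξ‖ = ‖a‖ * ‖ξ‖ := by
    intro ξ
    simp [L, mul_comm]
  have := lintegral_kap_similarity p L ‖a‖ ha' hL
    (fun ξ => ‖Complex.exp (Complex.I * (ξ.re : ℂ)) - 1‖ₑ ^ q) (by fun_prop)
  rw [← ENNReal.ofReal_rpow_of_pos ha', ofReal_norm] at this
  unfold c0
  rw [← this]
  apply lintegral_congr
  intro ξ
  have : (L ξ).re = ((starRingEnd ℂ ξ) * a).re := by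
    simp [L]
  rw [this]

open MeasureTheory ENNReal
set_option linter.unusedSectionVars false

/-- The data from which the new action is built. -/
structure Model {G : Type*} [Group G] [TopologicalSpace G]
    {X : Type*} [MeasurableSpace X] {μ : Measure X} {p : ℝ}
    (α : AffineIsometricAction G μ p) (q : ℝ) {Y : Type*} [mY : MeasurableSpace Y]
    (ν : Measure Y) (Ψ : Lp ℂ (ENNReal.ofReal p) μ → Y → ℂ) (S : G → Y → Y) : Prop where
  meas : ∀ f, Measurable (Ψ f)
  unim : ∀ f y, ‖Ψ f y‖ = 1
  add : ∀ f f', Ψ (f + f') =ᵐ[ν] Ψ f * Ψ f'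
  norm : ∀ f, NN ν q (Ψ f - 1) = NN μ p f
  mp : ∀ g, MeasurePreserving (S g) ν ν
  equiv : ∀ g f, (Ψ f) ∘ (S g) =ᵐ[ν] Ψ (linPart α g f)
  gen : ∀ m : MeasurableSpace Y, m ≤ mY → (∀ N, MeasurableSet[mY] N → ν N = 0 → MeasurableSet[m] N) →
    (∀ A, MeasurableSet[mY] A → (∀ g, S g ⁻¹' A = A) → MeasurableSet[m] A) →
    (∀ f (F : Y → ℂ), Measurable[mY] F → F =ᵐ[ν] Ψ f → Measurable[m] F) → mY ≤ m
  cover : ∃ f : ℕ → Lp ℂ (ENNReal.ofReal p) μ, ∀ᵐ y ∂ν, ∃ n, Ψ (f n) y ≠ 1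

namespace Model
variable {G : Type*} [Group G] [TopologicalSpace G]
    {X : Type*} [MeasurableSpace X] {μ : Measure X} {p : ℝ}
    {α : AffineIsometricAction G μ p} {q : ℝ} {Y : Type*} [mY : MeasurableSpace Y]
    {ν : Measure Y} {Ψ : Lp ℂ (ENNReal.ofReal p) μ → Y → ℂ} {S : G → Y → Y}

/-- the σ-algebra on which two maps agree -/
@[reducible] def agreeAlg (ν : Measure Y) (R R' : Y → Y) : MeasurableSpace Y where
  MeasurableSet' := fun A => MeasurableSet A ∧ R ⁻¹' A =ᵐ[ν] R' ⁻¹' A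
  measurableSet_empty := ⟨MeasurableSet.empty, by simp⟩
  measurableSet_compl := fun A hA => ⟨hA.1.compl, by
        have := hA.2.compl
        simpa using this⟩
  measurableSet_iUnion := fun A hA => ⟨MeasurableSet.iUnion fun i => (hA i).1, by
        rw [Set.preimage_iUnion, Set.preimage_iUnion]
        exact Filter.EventuallyEq.countable_iUnion fun i => (hA i).2⟩

lemma ae_eq [StandardBorelSpace Y] (M : Model α q ν Ψ S) {R R' : Y → Y}
    (hR : Measure.QuasiMeasurePreserving R ν ν)
    (hR' : Measure.QuasiMeasurePreserving R' ν ν) (h1 : ∀ f, Ψ f ∘ R =ᵐ[ν] Ψ f ∘ R')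
    (h2 : ∀ A, MeasurableSet A → (∀ g, S g ⁻¹' A = A) → R ⁻¹' A =ᵐ[ν] R' ⁻¹' A) :
    R =ᵐ[ν] R' := by
  have hm : mY ≤ agreeAlg ν R R' := by
    apply M.gen (agreeAlg ν R R') (fun A hA => hA.1)
    · intro N hN hN0
      refine ⟨hN, ?_⟩
      have e1 : R ⁻¹' N =ᵐ[ν] (∅ : Set Y) := ae_eq_empty.mpr (hR.preimage_null hN0)
      have e2 : R' ⁻¹' N =ᵐ[ν] (∅ : Set Y) := ae_eq_empty.mpr (hR'.preimage_null hN0)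
      exact e1.trans e2.symm
    · intro A hA hAS
      exact ⟨hA, h2 A hA hAS⟩
    · intro f F hF hFΨ C hC
      refine ⟨hF hC, ?_⟩
      have e1 : F ∘ R =ᵐ[ν] F ∘ R' := by
        have a1 : F ∘ R =ᵐ[ν] Ψ f ∘ R := hR.ae_eq_comp hFΨ
        have a2 : F ∘ R' =ᵐ[ν] Ψ f ∘ R' := hR'.ae_eq_comp hFΨ
        exact a1.trans ((h1 f).trans a2.symm)
      rw [← Set.preimage_comp, ← Set.preimage_comp]
      filter_upwards [e1] with y hy
      apply propext
      show F (R y) ∈ C ↔ F (R' y) ∈ C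
      have : F (R y) = F (R' y) := hy
      rw [this]
  refine Filter.EventuallyEq.of_forall_separating_preimage MeasurableSet ?_
  intro A hA
  exact (hm A hA).2

lemma S_mul [StandardBorelSpace Y] (M : Model α q ν Ψ S) (g h : G) :
    S (g * h) =ᵐ[ν] S h ∘ S g := by
  refine M.ae_eq (M.mp _).quasiMeasurePreserving
    ((M.mp h).comp (M.mp g)).quasiMeasurePreserving ?_ ?_
  · intro f
    refine (M.equiv _ _).trans ?_
    rw [linPart_mul]
    refine (M.equiv _ _).symm.trans ?_
    exact (M.mp g).quasiMeasurePreserving.ae_eq_comp (M.equiv h f).symm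
  · intro A _ hA
    rw [hA, Set.preimage_comp, hA, hA]
    exact Filter.EventuallyEq.rfl

lemma S_one [StandardBorelSpace Y] (M : Model α q ν Ψ S) : S 1 =ᵐ[ν] id := by
  refine M.ae_eq (M.mp _).quasiMeasurePreserving
    (MeasurePreserving.id ν).quasiMeasurePreserving ?_ ?_
  · intro f
    refine (M.equiv _ _).trans ?_
    rw [linPart_one]; rfl
  · intro A _ hA
    rw [hA]; rfl

lemma Psi_zero (M : Model α q ν Ψ S) : Ψ 0 =ᵐ[ν] 1 := by
  have := M.add 0 0
  rw [add_zero] at this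
  filter_upwards [this] with y hy
  have hne : Ψ 0 y ≠ 0 := by
    intro h
    have := M.unim 0 y
    rw [h] at this; simp at this
  simp only [Pi.mul_apply] at hy
  exact (mul_eq_left₀ hne).mp hy.symm

lemma dPsi (M : Model α q ν Ψ S) (a b : Lp ℂ (ENNReal.ofReal p) μ) :
    NN ν q (Ψ a - Ψ b) = NN μ p ⇑(a - b) := by
  rw [← M.norm]
  have := M.add (a - b) b
  rw [sub_add_cancel] at this
  unfold NN
  apply lintegral_congr_ae
  filter_upwards [this] with y hy
  have e : (Ψ a - Ψ b) y = (Ψ (a - b) - 1) y * Ψ b y := by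
    simp only [Pi.sub_apply, hy, Pi.mul_apply, Pi.one_apply]; ring
  rw [e, enorm_mul]
  have : ‖Ψ b y‖ₑ = 1 := by rw [← ofReal_norm, M.unim]; simp
  rw [this, mul_one]

/-- `g ↦ k ∘ S g` is continuous in `L_q`. -/
def Good (q : ℝ) (ν : Measure Y) (S : G → Y → Y) (k : Y → ℂ) : Prop :=
  Measurable k ∧ ∀ g₀, Filter.Tendsto (fun g => NN ν q (k ∘ S g - k ∘ S g₀)) (nhds g₀) (nhds 0)

lemma tendsto_zero_of_le {ι : Type*} {l : Filter ι} {a b : ι → ℝ≥0∞} {C : ℝ≥0∞} (hC : C ≠ ⊤)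
    (hb : Filter.Tendsto b l (nhds 0)) (h : ∀ i, a i ≤ C * b i) :
    Filter.Tendsto a l (nhds 0) := by
  have h2 := ENNReal.Tendsto.const_mul (a := C) hb (Or.inr hC)
  rw [mul_zero] at h2
  exact tendsto_of_tendsto_of_tendsto_of_le_of_le tendsto_const_nhds h2 (fun _ => zero_le) h

lemma two_rpow_ne_top (hq : 0 < q) : (2 : ℝ≥0∞) ^ q ≠ ⊤ :=
  ENNReal.rpow_ne_top_of_nonneg hq.le (by simp)

lemma good_Psi (M : Model α q ν Ψ S) (hp : 0 < p) (f : Lp ℂ (ENNReal.ofReal p) μ) :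
    Good q ν S (Ψ f - 1) := by
  refine ⟨(M.meas f).sub measurable_const, fun g₀ => ?_⟩
  refine (linPart_tendsto α hp f g₀).congr fun g => ?_
  rw [← M.dPsi]
  apply NN_congr
  filter_upwards [M.equiv g f, M.equiv g₀ f] with y h1 h2
  simp only [Pi.sub_apply, Function.comp_apply] at *
  rw [← h1, ← h2]
  simp

lemma Good.lip (hq : 0 < q) {k : Y → ℂ} (hk : Good q ν S k) {φ : ℂ → ℂ} {K : NNReal}
    (hφ : LipschitzWith K φ) : Good q ν S (φ ∘ k) := by
  refine ⟨hφ.continuous.measurable.comp hk.1, fun g₀ => ?_⟩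
  refine tendsto_zero_of_le (C := (K : ℝ≥0∞) ^ q)
    (ENNReal.rpow_ne_top_of_nonneg hq.le (by simp)) (hk.2 g₀) fun g => ?_
  unfold NN
  rw [← lintegral_const_mul' _ _ (ENNReal.rpow_ne_top_of_nonneg hq.le (by simp))]
  apply lintegral_mono
  intro y
  simp only [Pi.sub_apply, Function.comp_apply]
  rw [← ENNReal.mul_rpow_of_nonneg _ _ hq.le, ← edist_eq_enorm_sub, ← edist_eq_enorm_sub]
  exact ENNReal.rpow_le_rpow (hφ _ _) hq.le

lemma Good.add (hq : 0 < q) (hS : ∀ g, Measurable (S g)) {k k' : Y → ℂ} (hk : Good q ν S k)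
    (hk' : Good q ν S k') : Good q ν S (k + k') := by
  refine ⟨hk.1.add hk'.1, fun g₀ => ?_⟩
  have h := (hk.2 g₀).add (hk'.2 g₀)
  rw [add_zero] at h
  refine tendsto_zero_of_le (two_rpow_ne_top hq) h fun g => ?_
  refine le_trans (le_of_eq ?_) (NN_add_le hq ?_)
  · congr 1; ext y; simp; ring
  · exact ((hk.1.comp (hS g)).sub (hk.1.comp (hS g₀))).aestronglyMeasurable

lemma Good.const_mul (hq : 0 < q) {k : Y → ℂ} (hk : Good q ν S k) (c : ℂ) :
    Good q ν S (fun y => c * k y) := by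
  refine ⟨hk.1.const_mul c, fun g₀ => ?_⟩
  refine tendsto_zero_of_le (C := ‖c‖ₑ ^ q)
    (ENNReal.rpow_ne_top_of_nonneg hq.le (by simp)) (hk.2 g₀) fun g => ?_
  rw [← NN_smul hq]
  refine le_of_eq ?_
  congr 1; ext y; simp; ring

lemma Good.mul (hq : 0 < q) (hS : ∀ g, Measurable (S g)) {k k' : Y → ℂ} (hk : Good q ν S k)
    (hk' : Good q ν S k') (h1 : ∀ y, ‖k y‖ ≤ 1) (h1' : ∀ y, ‖k' y‖ ≤ 1) :
    Good q ν S (k * k') := by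
  refine ⟨hk.1.mul hk'.1, fun g₀ => ?_⟩
  have h := (hk.2 g₀).add (hk'.2 g₀)
  rw [add_zero] at h
  refine tendsto_zero_of_le (two_rpow_ne_top hq) h fun g => ?_
  have e : (k * k') ∘ S g - (k * k') ∘ S g₀ =
      (k ∘ S g - k ∘ S g₀) * (k' ∘ S g) + (k ∘ S g₀) * (k' ∘ S g - k' ∘ S g₀) := by
    ext y; simp; ring
  rw [e]
  refine (NN_add_le hq ?_).trans ?_
  · exact (((hk.1.comp (hS g)).sub (hk.1.comp (hS g₀))).mul
      (hk'.1.comp (hS g))).aestronglyMeasurable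
  · gcongr
    · apply NN_mono_ae hq
      refine Filter.Eventually.of_forall fun y => ?_
      simp only [Pi.mul_apply, enorm_mul]
      refine mul_le_of_le_one_right' ?_
      rw [← ofReal_norm]; exact ENNReal.ofReal_le_one.mpr (h1' _)
    · apply NN_mono_ae hq
      refine Filter.Eventually.of_forall fun y => ?_
      simp only [Pi.mul_apply, enorm_mul]
      refine mul_le_of_le_one_left' ?_
      rw [← ofReal_norm]; exact ENNReal.ofReal_le_one.mpr (h1 _)

lemma NN_comp (hS : MeasurePreserving (S g) ν ν) {k : Y → ℂ} (hk : Measurable k) :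
    NN ν q (k ∘ S g) = NN ν q k := by
  unfold NN
  exact hS.lintegral_comp (f := fun y => ‖k y‖ₑ ^ q) (by fun_prop)

lemma Good.lim (hq : 0 < q) (hS : ∀ g, MeasurePreserving (S g) ν ν) {k : Y → ℂ}
    (hk : Measurable k) (h : ∀ ε : ℝ≥0∞, 0 < ε → ∃ k', Good q ν S k' ∧ NN ν q (k - k') ≤ ε) :
    Good q ν S k := by
  refine ⟨hk, fun g₀ => ?_⟩
  rw [ENNReal.tendsto_nhds_zero]
  intro ε hε
  set C : ℝ≥0∞ := 2 ^ q with hC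
  have hCt : C ≠ ⊤ := two_rpow_ne_top hq
  have hC0 : C ≠ 0 := by
    rw [hC]; exact (ENNReal.rpow_pos (by simp) (by simp)).ne'
  -- C * (δ + C * (δ + δ))
  set D : ℝ≥0∞ := C + C * C + C * C with hD
  have hDt : D ≠ ⊤ := by
    simp [hD, ENNReal.mul_ne_top, hCt]
  have hδ : 0 < ε / D := ENNReal.div_pos hε.ne' hDt
  obtain ⟨k', hk', hkk⟩ := h _ hδ
  have := (ENNReal.tendsto_nhds_zero.mp (hk'.2 g₀)) _ hδ
  filter_upwards [this] with g hg
  have m1 := fun g => (hk.comp (hS g).measurable).aestronglyMeasurable (μ := ν)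
  have m2 := fun g => (hk'.1.comp (hS g).measurable).aestronglyMeasurable (μ := ν)
  have c1 : ∀ g, NN ν q (k ∘ S g - k' ∘ S g) ≤ ε / D := by
    intro g
    have : k ∘ S g - k' ∘ S g = (k - k') ∘ S g := rfl
    rw [this, NN_comp (hS g) (hk.sub hk'.1)]
    exact hkk
  calc NN ν q (k ∘ S g - k ∘ S g₀)
      ≤ C * (NN ν q (k ∘ S g - k' ∘ S g) + NN ν q (k' ∘ S g - k ∘ S g₀)) :=
        NN_sub_le hq (m1 g) (m2 g)
    _ ≤ C * (NN ν q (k ∘ S g - k' ∘ S g) + C * (NN ν q (k' ∘ S g - k' ∘ S g₀)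
        + NN ν q (k' ∘ S g₀ - k ∘ S g₀))) := by
        gcongr; exact NN_sub_le hq (m2 g) (m2 g₀)
    _ ≤ C * (ε / D + C * (ε / D + ε / D)) := by
        gcongr
        · exact c1 g
        · rw [NN_sub_comm]; exact c1 g₀
    _ = (ε / D) * D := by rw [hD]; ring
    _ ≤ ε := (ENNReal.div_mul_cancel (by simp [hD, hC0]) hDt).le

/-- good sets -/
def GS (q : ℝ) (ν : Measure Y) (S : G → Y → Y) (A : Set Y) : Prop :=
  MeasurableSet A ∧ ν A < ⊤ ∧ Good q ν S (A.indicator 1)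

lemma norm_ind_le (A : Set Y) (y : Y) : ‖A.indicator (1 : Y → ℂ) y‖ ≤ 1 := by
  by_cases h : y ∈ A <;> simp [h]

lemma GS.of_tendsto (hq : 0 < q) (hS : ∀ g, MeasurePreserving (S g) ν ν) {A : Set Y}
    (hA : MeasurableSet A) (hA' : ν A < ⊤) (k : ℕ → Y → ℂ) (hk : ∀ n, Good q ν S (k n))
    (hlim : ∀ y ∈ A, Filter.Tendsto (fun n => k n y) Filter.atTop (nhds 1))
    (hb : ∀ n, ∀ y ∈ A, ‖1 - k n y‖ ≤ 1) (h0 : ∀ n, ∀ y ∉ A, k n y = 0) : GS q ν S A := by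
  refine ⟨hA, hA', ?_⟩
  have hm : Measurable (A.indicator (1 : Y → ℂ)) := measurable_one.indicator hA
  refine Good.lim hq hS hm fun ε hε => ?_
  have key : Filter.Tendsto (fun n => NN ν q (A.indicator 1 - k n)) Filter.atTop (nhds 0) := by
    have : (0 : ℝ≥0∞) = ∫⁻ y, (0 : ℝ≥0∞) ∂ν := by simp
    rw [this]
    unfold NN
    refine tendsto_lintegral_of_dominated_convergence (A.indicator 1) ?_ ?_ ?_ ?_
    · intro n
      have := (hk n).1
      simp only [Pi.sub_apply]
      fun_prop
    · intro n
      refine Filter.Eventually.of_forall fun y => ?_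
      by_cases hy : y ∈ A
      · simp only [Pi.sub_apply, hy, Set.indicator_of_mem, Pi.one_apply]
        rw [← ofReal_norm]
        refine ENNReal.rpow_le_one ?_ hq.le
        exact ENNReal.ofReal_le_one.mpr (hb n y hy)
      · simp [hy, h0 n y hy, hq]
    · rw [lintegral_indicator_one hA]; exact hA'.ne
    · refine Filter.Eventually.of_forall fun y => ?_
      by_cases hy : y ∈ A
      · have h1 := (hlim y hy).const_sub 1
        rw [sub_self] at h1
        have h2 := (h1.enorm).ennrpow_const q
        simp only [enorm_zero, ENNReal.zero_rpow_of_pos hq] at h2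
        refine h2.congr fun n => ?_
        simp [hy]
      · simp [hy, h0 _ y hy, hq]
  obtain ⟨n, hn⟩ := ((ENNReal.tendsto_nhds_zero.mp key) ε hε).exists
  exact ⟨k n, hk n, hn⟩

lemma GS.inter (hq : 0 < q) (hS : ∀ g, MeasurePreserving (S g) ν ν) {A B : Set Y}
    (hA : GS q ν S A) (hB : GS q ν S B) : GS q ν S (A ∩ B) := by
  refine ⟨hA.1.inter hB.1, (measure_mono Set.inter_subset_left).trans_lt hA.2.1, ?_⟩
  rw [Set.inter_indicator_one]
  exact hA.2.2.mul hq (fun g => (hS g).measurable) hB.2.2 (norm_ind_le A) (norm_ind_le B)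

lemma GS.diff (hq : 0 < q) (hS : ∀ g, MeasurePreserving (S g) ν ν) {A B : Set Y}
    (hA : GS q ν S A) (hB : GS q ν S B) : GS q ν S (A \ B) := by
  refine ⟨hA.1.diff hB.1, (measure_mono Set.sdiff_subset).trans_lt hA.2.1, ?_⟩
  have h := hA.2.2.add hq (fun g => (hS g).measurable) ((hA.inter hq hS hB).2.2.const_mul hq (-1))
  convert h using 1
  ext y
  by_cases h1 : y ∈ A <;> by_cases h2 : y ∈ B <;> simp [h1, h2]

lemma GS.union (hq : 0 < q) (hS : ∀ g, MeasurePreserving (S g) ν ν) {A B : Set Y}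
    (hA : GS q ν S A) (hB : GS q ν S B) : GS q ν S (A ∪ B) := by
  refine ⟨hA.1.union hB.1, (measure_union_le _ _).trans_lt (ENNReal.add_lt_top.mpr ⟨hA.2.1, hB.2.1⟩), ?_⟩
  have h := hB.2.2.add hq (fun g => (hS g).measurable) (hA.diff hq hS hB).2.2
  convert h using 1
  ext y
  by_cases h1 : y ∈ A <;> by_cases h2 : y ∈ B <;> simp [h1, h2]

lemma GS.empty (hq : 0 < q) : GS q ν S ∅ := by
  refine ⟨MeasurableSet.empty, by simp, by simp, fun g₀ => ?_⟩
  simp [NN, hq]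

lemma GS.iUnion (hq : 0 < q) (hS : ∀ g, MeasurePreserving (S g) ν ν) {A : ℕ → Set Y}
    (hA : ∀ n, GS q ν S (A n)) (hfin : ν (⋃ n, A n) < ⊤) : GS q ν S (⋃ n, A n) := by
  have hacc : ∀ n, GS q ν S (Set.accumulate A n) := by
    intro n
    induction n with
    | zero => simpa using hA 0
    | succ n ih => rw [Set.accumulate_succ]; exact ih.union hq hS (hA _)
  refine GS.of_tendsto hq hS (MeasurableSet.iUnion fun n => (hA n).1) hfin
    (fun n => (Set.accumulate A n).indicator 1) (fun n => (hacc n).2.2) ?_ ?_ ?_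
  · intro y hy
    obtain ⟨n, hn⟩ := Set.mem_iUnion.mp hy
    refine tendsto_const_nhds.congr' ?_
    filter_upwards [Filter.eventually_ge_atTop n] with i hi
    have : y ∈ Set.accumulate A i := Set.mem_accumulate.mpr ⟨n, hi, hn⟩
    simp [this]
  · intro n y _
    by_cases h : y ∈ Set.accumulate A n <;> simp [h]
  · intro n y hy
    have : y ∉ Set.accumulate A n := fun h => hy (Set.accumulate_subset_iUnion n h)
    simp [this]

lemma GS.congr (hS : ∀ g, MeasurePreserving (S g) ν ν) {A B : Set Y}
    (hA : GS q ν S A) (hB : MeasurableSet B) (h : A =ᵐ[ν] B) : GS q ν S B := by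
  refine ⟨hB, by rw [← measure_congr h]; exact hA.2.1, measurable_one.indicator hB, fun g₀ => ?_⟩
  refine (hA.2.2.2 g₀).congr fun g => ?_
  have e : ∀ g, A.indicator (1 : Y → ℂ) ∘ S g =ᵐ[ν] B.indicator (1 : Y → ℂ) ∘ S g := fun g =>
    (hS g).quasiMeasurePreserving.ae_eq_comp (indicator_ae_eq_of_ae_eq_set h)
  exact NN_congr ((e g).sub (e g₀))

lemma GS_preimage (M : Model α q ν Ψ S) (hp : 0 < p) (hq : 0 < q)
    (f : Lp ℂ (ENNReal.ofReal p) μ) (V : Set ℂ) (hV : IsOpen V) (ε : ℝ) (hε : 0 < ε)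
    (hVε : ∀ z ∈ V, ε ≤ ‖z‖) : GS q ν S ((Ψ f - 1) ⁻¹' V) := by
  have hfin : NN ν q (Ψ f - 1) < ⊤ := by
    rw [M.norm]; exact ((memLp_iff_NN hp).mp (Lp.memLp f)).2
  have hmeas : Measurable (Ψ f - 1) := (M.good_Psi hp f).1
  have h0 : (0 : ℂ) ∈ Vᶜ := fun h => by
    have := hVε 0 h
    simp at this; linarith
  have hA : MeasurableSet ((Ψ f - 1) ⁻¹' V) := hmeas hV.measurableSet
  let φ : ℕ → ℂ → ℂ := fun n z => ((min 1 (n * Metric.infDist z Vᶜ) : ℝ) : ℂ)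
  have hφ : ∀ n : ℕ, LipschitzWith (1 * (0 ⊔ (‖(n:ℝ)‖₊ * 1))) (φ n) := by
    intro n
    refine Complex.isometry_ofReal.lipschitz.comp ?_
    have h1 : LipschitzWith (‖(n:ℝ)‖₊ * 1) (fun z => (n:ℝ) * Metric.infDist z Vᶜ) := by
      have := (lipschitzWith_smul (n:ℝ) (β := ℝ)).comp (Metric.lipschitz_infDist_pt Vᶜ)
      exact this
    exact (LipschitzWith.const (1:ℝ)).min h1
  refine GS.of_tendsto hq M.mp hA ?_ (fun n => φ n ∘ (Ψ f - 1))
    (fun n => (M.good_Psi hp f).lip hq (hφ n)) ?_ ?_ ?_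
  · have h1 : (Ψ f - 1) ⁻¹' V ⊆ {y | ENNReal.ofReal ε ^ q ≤ ‖(Ψ f - 1) y‖ₑ ^ q} := by
      intro y hy
      have := hVε _ hy
      show ENNReal.ofReal ε ^ q ≤ ‖(Ψ f - 1) y‖ₑ ^ q
      rw [← ofReal_norm]
      gcongr
    refine (measure_mono h1).trans_lt ?_
    refine (meas_ge_le_lintegral_div (by fun_prop) ?_ ?_).trans_lt (ENNReal.div_lt_top hfin.ne ?_)
    · exact (ENNReal.rpow_pos (by simpa using hε) (by simp)).ne'
    · exact ENNReal.rpow_ne_top_of_nonneg hq.le (by simp)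
    · exact (ENNReal.rpow_pos (by simpa using hε) (by simp)).ne'
  · intro y hy
    have hd : 0 < Metric.infDist ((Ψ f - 1) y) Vᶜ := by
      refine (hV.isClosed_compl.notMem_iff_infDist_pos ⟨0, h0⟩).mp ?_
      simpa using hy
    obtain ⟨N, hN⟩ := exists_nat_gt (1 / Metric.infDist ((Ψ f - 1) y) Vᶜ)
    refine tendsto_const_nhds.congr' ?_
    filter_upwards [Filter.eventually_ge_atTop N] with n hn
    have : 1 ≤ (n:ℝ) * Metric.infDist ((Ψ f - 1) y) Vᶜ := by
      rw [div_lt_iff₀ hd] at hN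
      refine hN.le.trans ?_
      gcongr
    show (1:ℂ) = ((min 1 (n * Metric.infDist _ Vᶜ) : ℝ) : ℂ)
    rw [min_eq_left this]; simp
  · intro n y _
    show ‖(1:ℂ) - ((min 1 (n * Metric.infDist _ Vᶜ) : ℝ) : ℂ)‖ ≤ 1
    set t := (n:ℝ) * Metric.infDist ((Ψ f - 1) y) Vᶜ
    have ht : 0 ≤ t := mul_nonneg (Nat.cast_nonneg _) Metric.infDist_nonneg
    rw [← Complex.ofReal_one, ← Complex.ofReal_sub, Complex.norm_real, Real.norm_eq_abs, abs_le]
    have := min_le_left 1 t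
    have : 0 ≤ min 1 t := le_min zero_le_one ht
    constructor <;> linarith
  · intro n y hy
    show ((min 1 (n * Metric.infDist _ Vᶜ) : ℝ) : ℂ) = 0
    rw [Metric.infDist_zero_of_mem (by exact hy)]
    simp

/-- the σ-algebra of sets with good traces -/
@[reducible] def goodAlg (hq : 0 < q) (hS : ∀ g, MeasurePreserving (S g) ν ν) : MeasurableSpace Y where
  MeasurableSet' := fun A => MeasurableSet A ∧ ∀ B, GS q ν S B → GS q ν S (B ∩ A)
  measurableSet_empty := ⟨MeasurableSet.empty, fun B _ => by
    rw [Set.inter_empty]; exact GS.empty hq⟩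
  measurableSet_compl := fun A hA => ⟨hA.1.compl, fun B hB => by
    have := hB.diff hq hS (hA.2 B hB)
    convert this using 1
    ext y; simp⟩
  measurableSet_iUnion := fun A hA => ⟨MeasurableSet.iUnion fun i => (hA i).1, fun B hB => by
    rw [Set.inter_iUnion]
    refine GS.iUnion hq hS (fun n => (hA n).2 B hB) ?_
    exact (measure_mono (Set.iUnion_subset fun n => Set.inter_subset_left)).trans_lt hB.2.1⟩

lemma le_goodAlg (M : Model α q ν Ψ S) (hp : 0 < p) (hq : 0 < q) : mY ≤ goodAlg hq M.mp := by
  have hnull : ∀ N, MeasurableSet N → ν N = 0 → MeasurableSet[goodAlg hq M.mp] N := by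
    intro N hN h0
    refine ⟨hN, fun B hB => ?_⟩
    refine (GS.empty hq).congr M.mp (hB.1.inter hN) ?_
    refine (ae_eq_empty.mpr ?_).symm
    exact measure_mono_null Set.inter_subset_right h0
  refine M.gen _ (fun A hA => hA.1) hnull ?_ ?_
  · intro A hA hAS
    refine ⟨hA, fun B hB => ⟨hB.1.inter hA, (measure_mono Set.inter_subset_left).trans_lt hB.2.1,
      measurable_one.indicator (hB.1.inter hA), fun g₀ => ?_⟩⟩
    refine tendsto_of_tendsto_of_tendsto_of_le_of_le tendsto_const_nhds (hB.2.2.2 g₀)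
      (fun _ => zero_le) fun g => ?_
    apply NN_mono_ae hq
    refine Filter.Eventually.of_forall fun y => ?_
    have hy : ∀ g, S g y ∈ A ↔ y ∈ A := fun g => by
      conv_rhs => rw [← hAS g]
      rfl
    classical
    have hind : ∀ g, (B ∩ A).indicator (1 : Y → ℂ) (S g y) =
        if y ∈ A then B.indicator (1 : Y → ℂ) (S g y) else 0 := fun g => by
      by_cases h : y ∈ A <;> by_cases hB : S g y ∈ B <;> simp [hy, h, hB]
    simp only [Pi.sub_apply, Function.comp_apply, hind]
    split_ifs <;> simp
  · intro f F hF hFΨ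
    have hopen : ∀ V : Set ℂ, IsOpen V → (0:ℂ) ∉ V →
        MeasurableSet[goodAlg hq M.mp] ((Ψ f - 1) ⁻¹' V) := by
      intro V hV h0
      have e : V = ⋃ n : ℕ, V ∩ {z | 1 / ((n:ℝ) + 1) < ‖z‖} := by
        ext z
        simp only [Set.mem_iUnion, Set.mem_inter_iff, exists_and_left]
        refine ⟨fun hz => ⟨hz, ?_⟩, fun h => h.1⟩
        have : z ≠ 0 := fun h => h0 (h ▸ hz)
        exact exists_nat_one_div_lt (norm_pos_iff.mpr this)
      rw [e, Set.preimage_iUnion]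
      refine MeasurableSet.iUnion fun n => ?_
      have hG := M.GS_preimage hp hq f (V ∩ {z | 1 / ((n:ℝ) + 1) < ‖z‖})
        (hV.inter (isOpen_lt continuous_const continuous_norm)) (1 / ((n:ℝ) + 1)) (by positivity)
        (fun z hz => le_of_lt hz.2)
      exact ⟨hG.1, fun B hB => hB.inter hq M.mp hG⟩
    have hmeas : Measurable[goodAlg hq M.mp] (Ψ f - 1) := by
      refine @measurable_of_isOpen _ _ _ _ _ (goodAlg hq M.mp) _ ?_
      intro V hV
      by_cases h0 : (0:ℂ) ∈ V
      · have e : (Ψ f - 1) ⁻¹' V = (Ψ f - 1) ⁻¹' (V \ {0}) ∪ ((Ψ f - 1) ⁻¹' {0}ᶜ)ᶜ := by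
          rw [← Set.preimage_compl, compl_compl, ← Set.preimage_union, Set.sdiff_union_self]
          rw [Set.union_eq_self_of_subset_right (Set.singleton_subset_iff.mpr h0)]
        rw [e]
        refine MeasurableSet.union (hopen _ (hV.sdiff isClosed_singleton) (by simp)) ?_
        exact (hopen _ isOpen_compl_singleton (by simp)).compl
      · exact hopen V hV h0
    have hΨ : Measurable[goodAlg hq M.mp] (Ψ f) := by
      have h1 : Measurable (fun z : ℂ => z + 1) := measurable_id.add_const 1
      have := h1.comp hmeas
      have e : (fun z : ℂ => z + 1) ∘ (Ψ f - 1) = Ψ f := by ext y; simp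
      rwa [e] at this
    intro C hC
    have hN : ν {y | F y ≠ Ψ f y} = 0 := hFΨ
    have hNm : MeasurableSet[mY] {y | F y ≠ Ψ f y} :=
      (measurableSet_eq_fun (m := mY) hF (M.meas f)).compl
    have e : F ⁻¹' C = (Ψ f ⁻¹' C \ {y | F y ≠ Ψ f y}) ∪ ({y | F y ≠ Ψ f y} ∩ F ⁻¹' C) := by
      ext y
      by_cases h : F y = Ψ f y <;> simp [h]
    rw [e]
    refine MeasurableSet.union (MeasurableSet.diff (hΨ hC) (hnull _ hNm hN)) ?_
    exact hnull _ (hNm.inter (hF hC)) (measure_mono_null Set.inter_subset_left hN)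

lemma GS_all (M : Model α q ν Ψ S) (hp : 0 < p) (hq : 0 < q) {A : Set Y}
    (hA : MeasurableSet A) (hfin : ν A < ⊤) : GS q ν S A := by
  obtain ⟨f, hf⟩ := M.cover
  let B : ℕ → ℕ → Set Y := fun i j => (Ψ (f i) - 1) ⁻¹' {z | 1 / ((j:ℝ) + 1) < ‖z‖}
  have hB : ∀ i j, GS q ν S (B i j) := fun i j =>
    M.GS_preimage hp hq _ _ (isOpen_lt continuous_const continuous_norm) (1 / ((j:ℝ) + 1))
      (by positivity) (fun z hz => le_of_lt hz)
  have hAB : ∀ i j, GS q ν S (B i j ∩ A) := fun i j => (M.le_goodAlg hp hq A hA).2 _ (hB i j)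
  have hsub : ∀ i, ⋃ j, B i j ∩ A ⊆ A := fun i => Set.iUnion_subset fun j => Set.inter_subset_right
  have h1 : ∀ i, GS q ν S (⋃ j, B i j ∩ A) := fun i => GS.iUnion hq M.mp (hAB i)
    ((measure_mono (hsub i)).trans_lt hfin)
  have h2 : GS q ν S (⋃ i, ⋃ j, B i j ∩ A) := GS.iUnion hq M.mp h1
    ((measure_mono (Set.iUnion_subset hsub)).trans_lt hfin)
  refine h2.congr M.mp hA ?_
  filter_upwards [hf] with y hy
  apply propext
  show y ∈ (⋃ i, ⋃ j, B i j ∩ A) ↔ y ∈ A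
  refine ⟨fun h => Set.iUnion_subset hsub h, fun h => ?_⟩
  obtain ⟨i, hi⟩ := hy
  have hne : (Ψ (f i) - 1) y ≠ 0 := by simpa [sub_eq_zero] using hi
  obtain ⟨j, hj⟩ := exists_nat_one_div_lt (norm_pos_iff.mpr hne)
  exact Set.mem_iUnion.mpr ⟨i, Set.mem_iUnion.mpr ⟨j, hj, h⟩⟩

/-- approximation by bounded good functions -/
lemma approx (M : Model α q ν Ψ S) (hp : 0 < p) (hq : 0 < q) {k : Y → ℂ}
    (hk : MemLp k (ENNReal.ofReal q) ν) (ε : ℝ≥0∞) (hε : 0 < ε) :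
    ∃ k', (Good q ν S k' ∧ ∃ C : ℝ, ∀ y, ‖k' y‖ ≤ C) ∧ NN ν q (k - k') ≤ ε := by
  have := MemLp.induction_dense (μ := ν) (p := ENNReal.ofReal q) ENNReal.ofReal_ne_top
    (fun k' : Y → ℂ => Good q ν S k' ∧ ∃ C : ℝ, ∀ y, ‖k' y‖ ≤ C) ?_ ?_ ?_ hk
    (ε := ε ^ (1 / q)) (ENNReal.rpow_pos_of_nonneg hε (by positivity)).ne'
  · obtain ⟨g, h1, h2⟩ := this
    refine ⟨g, h2, (NN_le_of_eLpNorm hq h1).trans (le_of_eq ?_)⟩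
    rw [← ENNReal.rpow_mul, one_div, inv_mul_cancel₀ hq.ne', ENNReal.rpow_one]
  · intro c s hs hfin ε hε
    refine ⟨s.indicator fun _ => c, by simp, ?_, ‖c‖, ?_⟩
    · have := (M.GS_all hp hq hs hfin).2.2.const_mul hq c
      convert this using 1
      ext y
      by_cases h : y ∈ s <;> simp [h]
    · intro y
      by_cases h : y ∈ s <;> simp [h]
  · rintro f g ⟨hf, C, hC⟩ ⟨hg, D, hD⟩
    refine ⟨hf.add hq (fun g => (M.mp g).measurable) hg, C + D, fun y => ?_⟩
    exact (norm_add_le _ _).trans (add_le_add (hC y) (hD y))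
  · rintro f ⟨hf, _⟩
    exact hf.1.aestronglyMeasurable

lemma good_all (M : Model α q ν Ψ S) (hp : 0 < p) (hq : 0 < q) {k : Y → ℂ} (hkm : Measurable k)
    (hk : MemLp k (ENNReal.ofReal q) ν) : Good q ν S k := by
  refine Good.lim hq M.mp hkm fun ε hε => ?_
  obtain ⟨k', h, h'⟩ := M.approx hp hq hk ε hε
  exact ⟨k', h.1, h'⟩

/-- the underlying function of the new action -/
noncomputable def bfun (α : AffineIsometricAction G μ p)
    (Ψ : Lp ℂ (ENNReal.ofReal p) μ → Y → ℂ) (S : G → Y → Y) (g : G) (F : Y → ℂ) : Y → ℂ :=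
  fun y => Ψ (α.act g 0) y * (F (S g y) + 1) - 1

lemma enorm_Psi (M : Model α q ν Ψ S) (f : Lp ℂ (ENNReal.ofReal p) μ) (y : Y) :
    ‖Ψ f y‖ₑ = 1 := by rw [← ofReal_norm, M.unim]; simp

lemma bfun_memLp (M : Model α q ν Ψ S) (hp : 0 < p) (hq : 0 < q) (g : G)
    (F : Lp ℂ (ENNReal.ofReal q) ν) : MemLp (bfun α Ψ S g F) (ENNReal.ofReal q) ν := by
  have h1 : MemLp (fun y => F (S g y)) (ENNReal.ofReal q) ν :=
    (Lp.memLp F).comp_measurePreserving (M.mp g)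
  have h2 : MemLp (Ψ (α.act g 0) - 1) (ENNReal.ofReal q) ν := by
    rw [memLp_iff_NN hq]
    refine ⟨((M.meas _).sub measurable_const).aestronglyMeasurable, ?_⟩
    rw [M.norm]; exact ((memLp_iff_NN hp).mp (Lp.memLp _)).2
  have h3 : MemLp (fun y => Ψ (α.act g 0) y * F (S g y)) (ENNReal.ofReal q) ν := by
    refine h1.of_le ((M.meas _).aestronglyMeasurable.mul h1.1)
      (Filter.Eventually.of_forall fun y => ?_)
    rw [norm_mul, M.unim, one_mul]
  refine (h3.add h2).congr_norm ?_ (Filter.Eventually.of_forall fun y => ?_)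
  · have := h1.1
    have h4 := (M.meas (α.act g 0)).aestronglyMeasurable (μ := ν)
    unfold bfun
    exact (h4.mul (this.add aestronglyMeasurable_const)).sub aestronglyMeasurable_const
  · congr 1
    simp only [bfun, Pi.add_apply, Pi.sub_apply, Pi.one_apply]; ring

lemma bfun_congr (M : Model α q ν Ψ S) (g : G) {F F' : Y → ℂ} (h : F =ᵐ[ν] F') :
    bfun α Ψ S g F =ᵐ[ν] bfun α Ψ S g F' := by
  filter_upwards [(M.mp g).quasiMeasurePreserving.ae_eq_comp h] with y hy
  simp only [Function.comp_apply] at hy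
  simp only [bfun, hy]

lemma bfun_sub (M : Model α q ν Ψ S) (g : G) {F F' : Y → ℂ} (h : AEStronglyMeasurable (F - F') ν) :
    NN ν q (bfun α Ψ S g F - bfun α Ψ S g F') = NN ν q (F - F') := by
  have e : NN ν q (bfun α Ψ S g F - bfun α Ψ S g F') = NN ν q ((F - F') ∘ S g) := by
    unfold NN
    congr 1; ext y
    have : (bfun α Ψ S g F - bfun α Ψ S g F') y
        = Ψ (α.act g 0) y * ((F - F') (S g y)) := by
      simp only [bfun, Pi.sub_apply]; ring
    rw [this, enorm_mul, M.enorm_Psi, one_mul]; rfl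
  rw [e]
  have h1 : h.mk _ ∘ S g =ᵐ[ν] (F - F') ∘ S g :=
    (M.mp g).quasiMeasurePreserving.ae_eq_comp h.ae_eq_mk.symm
  rw [← NN_congr h1, NN_comp (M.mp g) h.stronglyMeasurable_mk.measurable]
  exact NN_congr h.ae_eq_mk.symm

lemma bfun_mul [StandardBorelSpace Y] (M : Model α q ν Ψ S) (g h : G) (F : Y → ℂ) :
    bfun α Ψ S (g * h) F =ᵐ[ν] bfun α Ψ S g (bfun α Ψ S h F) := by
  have h1 := M.add (linPart α g (α.act h 0)) (α.act g 0)
  rw [← act_mul_zero] at h1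
  filter_upwards [M.S_mul g h, h1, M.equiv g (α.act h 0)] with y a1 a2 a3
  simp only [Function.comp_apply, Pi.mul_apply] at a1 a2 a3
  simp only [bfun, a1, a2, a3]
  ring

lemma bfun_one [StandardBorelSpace Y] (M : Model α q ν Ψ S) (F : Y → ℂ) :
    bfun α Ψ S 1 F =ᵐ[ν] F := by
  filter_upwards [M.S_one, M.Psi_zero] with y a1 a2
  simp only [bfun, a1, α.act_one, a2]
  simp

lemma tendsto_mulPsi (M : Model α q ν Ψ S) (hp : 0 < p) (hq : 0 < q) (g₀ : G) {k : Y → ℂ}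
    (hk : MemLp k (ENNReal.ofReal q) ν) :
    Filter.Tendsto (fun g => NN ν q (fun y => k y * (Ψ (α.act g 0) y - Ψ (α.act g₀ 0) y)))
      (nhds g₀) (nhds 0) := by
  rw [ENNReal.tendsto_nhds_zero]
  intro ε hε
  set C : ℝ≥0∞ := 2 ^ q with hC
  have hCt : C ≠ ⊤ := two_rpow_ne_top hq
  have hC0 : C ≠ 0 := by
    rw [hC]; exact (ENNReal.rpow_pos (by simp) (by simp)).ne'
  set D : ℝ≥0∞ := C * C + C with hD
  have hDt : D ≠ ⊤ := by
    simp [hD, ENNReal.mul_ne_top, hCt]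
  have hδ : 0 < ε / D := ENNReal.div_pos hε.ne' hDt
  obtain ⟨k', ⟨hk', K, hK⟩, hkk⟩ := M.approx hp hq hk _ hδ
  have t1 : Filter.Tendsto (fun g => ‖(K:ℂ)‖ₑ ^ q * NN ν q (Ψ (α.act g 0) - Ψ (α.act g₀ 0)))
      (nhds g₀) (nhds 0) := by
    simp_rw [M.dPsi]
    have := ENNReal.Tendsto.const_mul (a := ‖(K:ℂ)‖ₑ ^ q) (act_tendsto α 0 g₀)
      (Or.inr (ENNReal.rpow_ne_top_of_nonneg hq.le (by simp)))
    rwa [mul_zero] at this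
  filter_upwards [ENNReal.tendsto_nhds_zero.mp t1 _ hδ] with g hg
  have hmΨ : Measurable (fun y => Ψ (α.act g 0) y - Ψ (α.act g₀ 0) y) :=
    (M.meas _).sub (M.meas _)
  have e : (fun y => k y * (Ψ (α.act g 0) y - Ψ (α.act g₀ 0) y)) =
     (fun y => (k - k') y * (Ψ (α.act g 0) y - Ψ (α.act g₀ 0) y)) +
     (fun y => k' y * (Ψ (α.act g 0) y - Ψ (α.act g₀ 0) y)) := by
    ext y; simp only [Pi.add_apply, Pi.sub_apply]; ring
  rw [e]
  refine (NN_add_le hq ?_).trans ?_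
  · exact (hk.1.sub hk'.1.aestronglyMeasurable).mul hmΨ.aestronglyMeasurable
  have b1 : NN ν q (fun y => (k - k') y * (Ψ (α.act g 0) y - Ψ (α.act g₀ 0) y)) ≤ C * (ε / D) := by
    refine le_trans ?_ (mul_le_mul_right hkk C)
    unfold NN
    rw [← lintegral_const_mul' _ _ hCt]
    apply lintegral_mono
    intro y
    simp only
    rw [enorm_mul, ENNReal.mul_rpow_of_nonneg _ _ hq.le, mul_comm]
    gcongr
    refine ENNReal.rpow_le_rpow ?_ hq.le
    refine enorm_sub_le.trans ?_
    rw [M.enorm_Psi, M.enorm_Psi]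
    norm_num
  have b2 : NN ν q (fun y => k' y * (Ψ (α.act g 0) y - Ψ (α.act g₀ 0) y)) ≤ ε / D := by
    refine le_trans ?_ hg
    rw [← NN_smul hq]
    apply NN_mono_ae hq
    refine Filter.Eventually.of_forall fun y => ?_
    simp only [enorm_mul]
    gcongr
    · rw [← ofReal_norm, ← ofReal_norm]
      apply ENNReal.ofReal_le_ofReal
      refine (hK y).trans ?_
      rw [Complex.norm_real]
      exact le_abs_self K
    · exact le_rfl
  calc _ ≤ C * (C * (ε / D) + ε / D) := by gcongr
    _ = (ε / D) * D := by rw [hD]; ring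
    _ ≤ ε := (ENNReal.div_mul_cancel (by simp [hD, hC0]) hDt).le

lemma bfun_tendsto (M : Model α q ν Ψ S) (hp : 0 < p) (hq : 0 < q) (g₀ : G)
    {F : Y → ℂ} (hFm : Measurable F) (hF : MemLp F (ENNReal.ofReal q) ν) :
    Filter.Tendsto (fun g => NN ν q (bfun α Ψ S g F - bfun α Ψ S g₀ F)) (nhds g₀) (nhds 0) := by
  have hS := fun g => (M.mp g).measurable
  have t1 := (M.good_all hp hq hFm hF).2 g₀
  have t2 := M.tendsto_mulPsi hp hq g₀ (hF.comp_measurePreserving (M.mp g₀))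
  have t3 : Filter.Tendsto (fun g => NN ν q (Ψ (α.act g 0) - Ψ (α.act g₀ 0)))
      (nhds g₀) (nhds 0) := by
    simp_rw [M.dPsi]; exact act_tendsto α 0 g₀
  have t4 := ENNReal.Tendsto.const_mul (t2.add t3) (Or.inr (two_rpow_ne_top hq))
  have t5 := ENNReal.Tendsto.const_mul (t1.add t4) (Or.inr (two_rpow_ne_top hq))
  simp only [add_zero, mul_zero] at t5
  refine tendsto_of_tendsto_of_tendsto_of_le_of_le tendsto_const_nhds t5 (fun _ => zero_le)
    fun g => ?_
  have e : bfun α Ψ S g F - bfun α Ψ S g₀ F =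
      (fun y => Ψ (α.act g 0) y * (F ∘ S g - F ∘ S g₀) y) +
      ((fun y => (F ∘ S g₀) y * (Ψ (α.act g 0) y - Ψ (α.act g₀ 0) y)) +
        (Ψ (α.act g 0) - Ψ (α.act g₀ 0))) := by
    ext y
    simp only [bfun, Pi.add_apply, Pi.sub_apply, Function.comp_apply]
    ring
  simp only
  rw [e]
  have m1 : Measurable (fun y => Ψ (α.act g 0) y * (F ∘ S g - F ∘ S g₀) y) :=
    (M.meas _).mul ((hFm.comp (hS g)).sub (hFm.comp (hS g₀)))
  have m2 : Measurable (fun y => (F ∘ S g₀) y * (Ψ (α.act g 0) y - Ψ (α.act g₀ 0) y)) :=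
    (hFm.comp (hS g₀)).mul ((M.meas _).sub (M.meas _))
  refine (NN_add_le hq m1.aestronglyMeasurable).trans ?_
  gcongr
  · apply NN_mono_ae hq
    refine Filter.Eventually.of_forall fun y => ?_
    rw [enorm_mul, M.enorm_Psi, one_mul]
  · exact NN_add_le hq m2.aestronglyMeasurable

theorem core [StandardBorelSpace Y] (M : Model α q ν Ψ S) (hp : 0 < p) (hq : 0 < q) :
    ∃ β : AffineIsometricAction G ν q, ∀ g, pPow μ p (α.act g 0 : X →ₘ[μ] ℂ)
      = pPow ν q (β.act g 0 : Y →ₘ[ν] ℂ) := by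
  let act : G → Lp ℂ (ENNReal.ofReal q) ν → Lp ℂ (ENNReal.ofReal q) ν := fun g F =>
    (M.bfun_memLp hp hq g F).toLp
  have hact : ∀ g F, (act g F : Y → ℂ) =ᵐ[ν] bfun α Ψ S g F := fun g F => MemLp.coeFn_toLp _
  refine ⟨⟨act, ?_, ?_, ?_, ?_, ?_⟩, ?_⟩
  · intro F
    apply Lp.ext
    exact (hact 1 F).trans (M.bfun_one F)
  · intro g h F
    apply Lp.ext
    refine (hact _ F).trans ((M.bfun_mul g h F).trans ?_)
    exact (M.bfun_congr g (hact h F).symm).trans (hact g _).symm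
  · intro g F F'
    rw [pPow_sub, pPow_sub]
    rw [NN_congr ((hact g F).sub (hact g F'))]
    exact M.bfun_sub g ((Lp.memLp F).1.sub (Lp.memLp F').1)
  · intro g t F F'
    apply Lp.ext
    refine (hact _ _).trans ?_
    have h1 : (⇑(t • F + (1 - t) • F') : Y → ℂ) =ᵐ[ν] t • ⇑F + (1 - t) • ⇑F' :=
      (Lp.coeFn_add _ _).trans ((Lp.coeFn_smul _ _).add (Lp.coeFn_smul _ _))
    have h2 : (⇑(t • act g F + (1 - t) • act g F') : Y → ℂ) =ᵐ[ν]
        t • ⇑(act g F) + (1 - t) • ⇑(act g F') :=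
      (Lp.coeFn_add _ _).trans ((Lp.coeFn_smul _ _).add (Lp.coeFn_smul _ _))
    refine (M.bfun_congr g h1).trans (Filter.EventuallyEq.trans ?_ h2.symm)
    filter_upwards [hact g F, hact g F'] with y a1 a2
    simp only [Pi.add_apply, Pi.smul_apply, a1, a2, bfun, Complex.real_smul]
    push_cast
    ring
  · intro F g₀
    simp_rw [pPow_sub]
    refine (M.bfun_tendsto hp hq g₀ (Lp.stronglyMeasurable F).measurable (Lp.memLp F)).congr
      fun g => ?_
    exact NN_congr ((hact g F).symm.sub (hact g₀ F).symm)
  · intro g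
    rw [pPow_eq_NN, pPow_eq_NN]
    rw [NN_congr (hact g 0)]
    have : bfun α Ψ S g ⇑(0 : Lp ℂ (ENNReal.ofReal q) ν) =ᵐ[ν] Ψ (α.act g 0) - 1 := by
      refine (M.bfun_congr g (Lp.coeFn_zero _ _ _)).trans ?_
      filter_upwards with y
      simp [bfun]
    rw [NN_congr this, M.norm]

end Model

open MeasureTheory ENNReal

lemma rpow_add_lt_of_lt_one {r x y : ℝ} (hr : r < 1) (hx : 0 < x) (hy : 0 < y) :
    (x + y) ^ r < x ^ r + y ^ r := by
  have e : ∀ z : ℝ, 0 < z → z ^ r = z * z ^ (r - 1) := fun z hz => by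
    rw [Real.rpow_sub_one hz.ne']; field_simp
  have h1 := Real.rpow_lt_rpow_of_neg hx (by linarith : x < x + y) (by linarith : r - 1 < 0)
  have h2 := Real.rpow_lt_rpow_of_neg hy (by linarith : y < x + y) (by linarith : r - 1 < 0)
  rw [e _ hx, e _ hy, e _ (by linarith)]
  nlinarith

lemma rpow_add_lt_of_one_lt {r x y : ℝ} (hr : 1 < r) (hx : 0 < x) (hy : 0 < y) :
    x ^ r + y ^ r < (x + y) ^ r := by
  have e : ∀ z : ℝ, 0 < z → z ^ r = z * z ^ (r - 1) := fun z hz => by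
    rw [Real.rpow_sub_one hz.ne']; field_simp
  have h1 := Real.rpow_lt_rpow hx.le (by linarith : x < x + y) (by linarith : 0 < r - 1)
  have h2 := Real.rpow_lt_rpow hy.le (by linarith : y < x + y) (by linarith : 0 < r - 1)
  rw [e _ hx, e _ hy, e _ (by linarith)]
  nlinarith

lemma norm_rpow_eq {p : ℝ} (a : ℂ) : ‖a‖ ^ p = (‖a‖ ^ 2) ^ (p / 2) := by
  rw [← Real.rpow_natCast, ← Real.rpow_mul (norm_nonneg _)]
  congr 1; push_cast; ring

lemma par_sum (a b : ℂ) : ‖a + b‖ ^ 2 + ‖a - b‖ ^ 2 = 2 * (‖a‖ ^ 2 + ‖b‖ ^ 2) := by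
  have := parallelogram_law_with_norm ℝ a b
  nlinarith

lemma clarkson_lt {p : ℝ} (hp : 0 < p) (h2 : p < 2) {a b : ℂ} (ha : a ≠ 0) (hb : b ≠ 0) :
    ‖a + b‖ ^ p + ‖a - b‖ ^ p < 2 * (‖a‖ ^ p + ‖b‖ ^ p) := by
  have hx : 0 < ‖a‖ ^ 2 := by positivity
  have hy : 0 < ‖b‖ ^ 2 := by positivity
  have hr : p / 2 < 1 := by linarith
  rw [norm_rpow_eq (a + b), norm_rpow_eq (a - b), norm_rpow_eq a, norm_rpow_eq b]
  have h1 := rpow_add_lt_of_lt_one hr hx hy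
  have hc := (Real.concaveOn_rpow (by linarith : 0 ≤ p / 2) hr.le).2
    (show ‖a + b‖ ^ 2 ∈ Set.Ici (0:ℝ) by simp) (show ‖a - b‖ ^ 2 ∈ Set.Ici (0:ℝ) by simp)
    (show (0:ℝ) ≤ 1/2 by norm_num) (show (0:ℝ) ≤ 1/2 by norm_num) (by norm_num)
  simp only [smul_eq_mul] at hc
  rw [← mul_add, ← mul_add, par_sum, ← mul_assoc] at hc
  norm_num at hc
  linarith

lemma clarkson_gt {p : ℝ} (h2 : 2 < p) {a b : ℂ} (ha : a ≠ 0) (hb : b ≠ 0) :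
    2 * (‖a‖ ^ p + ‖b‖ ^ p) < ‖a + b‖ ^ p + ‖a - b‖ ^ p := by
  have hx : 0 < ‖a‖ ^ 2 := by positivity
  have hy : 0 < ‖b‖ ^ 2 := by positivity
  have hr : 1 < p / 2 := by linarith
  rw [norm_rpow_eq (a + b), norm_rpow_eq (a - b), norm_rpow_eq a, norm_rpow_eq b]
  have h1 := rpow_add_lt_of_one_lt hr hx hy
  have hc := (convexOn_rpow hr.le).2
    (show ‖a + b‖ ^ 2 ∈ Set.Ici (0:ℝ) by simp) (show ‖a - b‖ ^ 2 ∈ Set.Ici (0:ℝ) by simp)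
    (show (0:ℝ) ≤ 1/2 by norm_num) (show (0:ℝ) ≤ 1/2 by norm_num) (by norm_num)
  simp only [smul_eq_mul] at hc
  rw [← mul_add, ← mul_add, par_sum, ← mul_assoc] at hc
  norm_num at hc
  linarith

lemma clarkson_eq {p : ℝ} (hp : 0 < p) {a b : ℂ} (h : a * b = 0) :
    ‖a + b‖ ^ p + ‖a - b‖ ^ p = 2 * (‖a‖ ^ p + ‖b‖ ^ p) := by
  rcases mul_eq_zero.mp h with h | h <;> simp [h, Real.zero_rpow hp.ne'] <;> ring

section disj
variable {X : Type*} [MeasurableSpace X] {μ : Measure X} {p : ℝ}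

lemma enorm_rpow_eq (hp : 0 < p) (a : ℂ) : ‖a‖ₑ ^ p = ENNReal.ofReal (‖a‖ ^ p) := by
  rw [← ofReal_norm, ENNReal.ofReal_rpow_of_nonneg (norm_nonneg _) hp.le]

lemma enorm_lhs (hp : 0 < p) (a b : ℂ) : ‖a + b‖ₑ ^ p + ‖a - b‖ₑ ^ p =
    ENNReal.ofReal (‖a + b‖ ^ p + ‖a - b‖ ^ p) := by
  rw [enorm_rpow_eq hp, enorm_rpow_eq hp, ENNReal.ofReal_add (by positivity) (by positivity)]

lemma enorm_rhs (hp : 0 < p) (a b : ℂ) : 2 * (‖a‖ₑ ^ p + ‖b‖ₑ ^ p) =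
    ENNReal.ofReal (2 * (‖a‖ ^ p + ‖b‖ ^ p)) := by
  rw [enorm_rpow_eq hp, enorm_rpow_eq hp, ← ENNReal.ofReal_add (by positivity) (by positivity),
    ENNReal.ofReal_mul (by norm_num)]
  simp

lemma disj_iff (hp : 0 < p) (hp2 : p ≠ 2) {f g : X → ℂ} (hf : MemLp f (ENNReal.ofReal p) μ)
    (hg : MemLp g (ENNReal.ofReal p) μ) :
    NN μ p (f + g) + NN μ p (f - g) = 2 * (NN μ p f + NN μ p g) ↔
      ∀ᵐ x ∂μ, f x * g x = 0 := by
  have hfm := hf.1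
  have hgm := hg.1
  have e1 : NN μ p (f + g) + NN μ p (f - g) =
      ∫⁻ x, (‖f x + g x‖ₑ ^ p + ‖f x - g x‖ₑ ^ p) ∂μ := by
    unfold NN
    rw [← lintegral_add_left' (by fun_prop)]
    rfl
  have e2 : 2 * (NN μ p f + NN μ p g) = ∫⁻ x, 2 * (‖f x‖ₑ ^ p + ‖g x‖ₑ ^ p) ∂μ := by
    unfold NN
    rw [lintegral_const_mul' _ _ (by simp), lintegral_add_left' (by fun_prop)]
  have m1 : AEMeasurable (fun x => ‖f x + g x‖ₑ ^ p + ‖f x - g x‖ₑ ^ p) μ := by fun_prop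
  have m2 : AEMeasurable (fun x => 2 * (‖f x‖ₑ ^ p + ‖g x‖ₑ ^ p)) μ := by fun_prop
  have f1 : NN μ p (f + g) + NN μ p (f - g) ≠ ⊤ := by
    have h1 := ((memLp_iff_NN hp).mp (hf.add hg)).2
    have h2 := ((memLp_iff_NN hp).mp (hf.sub hg)).2
    exact (ENNReal.add_lt_top.mpr ⟨h1, h2⟩).ne
  have f2 : 2 * (NN μ p f + NN μ p g) ≠ ⊤ := by
    have h1 := ((memLp_iff_NN hp).mp hf).2
    have h2 := ((memLp_iff_NN hp).mp hg).2
    exact ENNReal.mul_ne_top (by simp) (ENNReal.add_lt_top.mpr ⟨h1, h2⟩).ne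
  have key : (∀ᵐ x ∂μ, f x * g x = 0) ↔ (fun x => ‖f x + g x‖ₑ ^ p + ‖f x - g x‖ₑ ^ p) =ᵐ[μ]
      (fun x => 2 * (‖f x‖ₑ ^ p + ‖g x‖ₑ ^ p)) := by
    constructor
    · intro h
      filter_upwards [h] with x hx
      rw [enorm_lhs hp, enorm_rhs hp, clarkson_eq hp hx]
    · intro h
      filter_upwards [h] with x hx
      rw [enorm_lhs hp, enorm_rhs hp] at hx
      rw [ENNReal.ofReal_eq_ofReal_iff (by positivity) (by positivity)] at hx
      by_contra hne
      obtain ⟨ha, hb⟩ := mul_ne_zero_iff.mp hne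
      rcases lt_or_gt_of_ne hp2 with h2 | h2
      · exact (clarkson_lt hp h2 ha hb).ne hx
      · exact (clarkson_gt h2 ha hb).ne' hx
  rw [key, e1, e2]
  constructor
  · intro h
    rw [e1] at f1; rw [e2] at f2
    rcases lt_or_gt_of_ne hp2 with h2 | h2
    · refine ae_eq_of_ae_le_of_lintegral_le ?_ f1 m2 h.ge
      filter_upwards with x
      rw [enorm_lhs hp, enorm_rhs hp]
      apply ENNReal.ofReal_le_ofReal
      by_cases h0 : f x * g x = 0
      · exact (clarkson_eq hp h0).le
      · obtain ⟨ha, hb⟩ := mul_ne_zero_iff.mp h0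
        exact (clarkson_lt hp h2 ha hb).le
    · refine (ae_eq_of_ae_le_of_lintegral_le ?_ f2 m1 h.le).symm
      filter_upwards with x
      rw [enorm_lhs hp, enorm_rhs hp]
      apply ENNReal.ofReal_le_ofReal
      by_cases h0 : f x * g x = 0
      · exact (clarkson_eq hp h0).ge
      · obtain ⟨ha, hb⟩ := mul_ne_zero_iff.mp h0
        exact (clarkson_gt h2 ha hb).le
  · exact lintegral_congr_ae

lemma LinIso.sub {T : Lp ℂ (ENNReal.ofReal p) μ → Lp ℂ (ENNReal.ofReal p) μ}
    (hT : LinIso μ p T) (f g : Lp ℂ (ENNReal.ofReal p) μ) : T (f - g) = T f - T g := by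
  rw [eq_sub_iff_add_eq, ← hT.add, sub_add_cancel]

lemma LinIso.disj {T : Lp ℂ (ENNReal.ofReal p) μ → Lp ℂ (ENNReal.ofReal p) μ}
    (hT : LinIso μ p T) (hp : 0 < p) (hp2 : p ≠ 2) {f g : Lp ℂ (ENNReal.ofReal p) μ}
    (h : ∀ᵐ x ∂μ, f x * g x = 0) : ∀ᵐ x ∂μ, T f x * T g x = 0 := by
  rw [← disj_iff hp hp2 (Lp.memLp _) (Lp.memLp _)] at h ⊢
  rw [← NN_congr (Lp.coeFn_add _ _), ← NN_congr (Lp.coeFn_sub _ _)] at h ⊢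
  rw [← hT.add, ← hT.sub, hT.iso, hT.iso, hT.iso, hT.iso]
  exact h

end disj

section point
variable {X : Type*} [MeasurableSpace X] [StandardBorelSpace X] {μ : Measure X}

lemma point_realization [Nonempty X] (Θ : Set X → Set X)
    (hm : ∀ B, MeasurableSet B → MeasurableSet (Θ B))
    (hc : ∀ B, MeasurableSet B → Θ Bᶜ =ᵐ[μ] (Θ B)ᶜ)
    (hu : ∀ B : ℕ → Set X, (∀ n, MeasurableSet (B n)) → Θ (⋃ n, B n) =ᵐ[μ] ⋃ n, Θ (B n)) :
    ∃ φ : X → X, Measurable φ ∧ ∀ B, MeasurableSet B → φ ⁻¹' B =ᵐ[μ] Θ B := by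
  classical
  let k : X → ℕ → Bool := MeasurableSpace.mapNatBool X
  have hk : MeasurableEmbedding k :=
    (MeasurableSpace.measurable_mapNatBool X).measurableEmbedding
      (MeasurableSpace.injective_mapNatBool X)
  let k' : X → ℕ → Bool := fun x n => decide (x ∈ Θ (k ⁻¹' {ω | ω n = true}))
  have hgm : ∀ n, MeasurableSet {ω : ℕ → Bool | ω n = true} := fun n =>
    measurableSet_eq_fun (measurable_pi_apply n) measurable_const
  have hk' : Measurable k' := by
    rw [measurable_pi_iff]
    intro n
    refine Measurable.of_discrete.comp (g := fun P : Prop => decide P) ?_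
    exact measurableSet_setOfPred.mp (hm _ (hk.measurable (hgm n)))
  have hpre : ∀ n, k' ⁻¹' {ω | ω n = true} = Θ (k ⁻¹' {ω | ω n = true}) := by
    intro n; ext x
    simp [k']
  have key : ∀ C : Set (ℕ → Bool), MeasurableSet C → k' ⁻¹' C =ᵐ[μ] Θ (k ⁻¹' C) := by
    let m : MeasurableSpace (ℕ → Bool) :=
    { MeasurableSet' := fun C => MeasurableSet C ∧ k' ⁻¹' C =ᵐ[μ] Θ (k ⁻¹' C)
      measurableSet_empty := ⟨MeasurableSet.empty, by
        have h1 := hu (fun _ => ∅) (fun _ => MeasurableSet.empty)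
        have h2 := hu (fun n => if n = 0 then ∅ else Set.univ) (fun n => by
          split_ifs <;> simp)
        have h3 := hc ∅ MeasurableSet.empty
        rw [Set.compl_empty] at h3
        have h4 : (⋃ n : ℕ, if n = 0 then (∅ : Set X) else Set.univ) = Set.univ := by
          apply Set.eq_univ_of_forall; intro x; exact Set.mem_iUnion.mpr ⟨1, by simp⟩
        have h5 : Θ ∅ ⊆ ⋃ n : ℕ, Θ (if n = 0 then (∅ : Set X) else Set.univ) := by
          intro x hx; exact Set.mem_iUnion.mpr ⟨0, by simpa using hx⟩
        rw [h4] at h2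
        simp only [Set.preimage_empty]
        filter_upwards [h2, h3] with x a2 a3
        apply propext
        show x ∈ (∅ : Set X) ↔ x ∈ Θ ∅
        have b2 : x ∈ Θ Set.univ ↔ x ∈ ⋃ n : ℕ, Θ (if n = 0 then (∅ : Set X) else Set.univ) :=
          iff_of_eq a2
        have b3 : x ∈ Θ Set.univ ↔ x ∉ Θ ∅ := iff_of_eq a3
        constructor
        · intro h; exact absurd h (Set.notMem_empty x)
        · intro h; exact absurd h (b3.mp (b2.mpr (h5 h)))⟩
      measurableSet_compl := fun C hC => ⟨hC.1.compl, by
        rw [Set.preimage_compl, Set.preimage_compl]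
        exact hC.2.compl.trans (hc _ (hk.measurable hC.1)).symm⟩
      measurableSet_iUnion := fun C hC => ⟨MeasurableSet.iUnion fun i => (hC i).1, by
        rw [Set.preimage_iUnion, Set.preimage_iUnion]
        exact (Filter.EventuallyEq.countable_iUnion fun i => (hC i).2).trans
          (hu _ fun n => hk.measurable (hC n).1).symm⟩ }
    have hle : MeasurableSpace.pi ≤ m := by
      refine iSup_le fun n => ?_
      rintro C ⟨D, hD, rfl⟩
      have hD' : D = ⋃ b ∈ D, {b} := by simp
      have hb : ∀ b : Bool, MeasurableSet[m] ((fun ω : ℕ → Bool => ω n) ⁻¹' {b}) := by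
        have ht : MeasurableSet[m] ((fun ω : ℕ → Bool => ω n) ⁻¹' {true}) :=
          ⟨hgm n, by
            have := hpre n
            exact Filter.EventuallyEq.of_eq this⟩
        intro b
        cases b with
        | true => exact ht
        | false =>
          have e : (fun ω : ℕ → Bool => ω n) ⁻¹' {false} =
            ((fun ω : ℕ → Bool => ω n) ⁻¹' {true})ᶜ := by ext ω; simp
          rw [e]; exact ht.compl
      rw [hD', Set.preimage_iUnion₂]
      exact MeasurableSet.biUnion (Set.to_countable D) fun b _ => hb b
    exact fun C hC => (hle C hC).2
  obtain ⟨g', hg', hgk⟩ := hk.exists_measurable_extend (measurable_id (α := X)) (fun _ => inferInstance)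
  refine ⟨g' ∘ k', hg'.comp hk', fun B hB => ?_⟩
  have := key _ (hg' hB)
  rw [← Set.preimage_comp, ← Set.preimage_comp, hgk] at this
  exact this

end point

open MeasureTheory ENNReal

/-- Data for the Banach-Lamperti theorem. -/
structure Lam {X : Type*} [MeasurableSpace X] (μ : Measure X) (p : ℝ) where
  T : Lp ℂ (ENNReal.ofReal p) μ → Lp ℂ (ENNReal.ofReal p) μ
  T' : Lp ℂ (ENNReal.ofReal p) μ → Lp ℂ (ENNReal.ofReal p) μ
  hT : LinIso μ p T
  hT' : LinIso μ p T'
  left : ∀ f, T' (T f) = f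
  right : ∀ f, T (T' f) = f
  h : X → ℝ
  hm : Measurable h
  pos : ∀ x, 0 < h x
  memLp : MemLp (fun x => (h x : ℂ)) (ENNReal.ofReal p) μ
  hp : 0 < p
  hp2 : p ≠ 2

namespace Lam
variable {X : Type*} [MeasurableSpace X] {μ : Measure X} {p : ℝ} (L : Lam μ p)

lemma ind_memLp {B : Set X} (hB : MeasurableSet B) (c : ℂ) :
    MemLp (B.indicator fun x => c * L.h x) (ENNReal.ofReal p) μ :=
  (L.memLp.const_mul c).indicator hB

open Classical in
/-- indicator times `c * h` as an element of `L_p` -/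
noncomputable def e (B : Set X) (c : ℂ) : Lp ℂ (ENNReal.ofReal p) μ :=
  if hB : MeasurableSet B then (L.ind_memLp hB c).toLp else 0

lemma e_coe {B : Set X} (hB : MeasurableSet B) (c : ℂ) :
    L.e B c =ᵐ[μ] B.indicator fun x => c * L.h x := by
  rw [e, dif_pos hB]; exact MemLp.coeFn_toLp _

lemma e_union {B B' : Set X} (hB : MeasurableSet B) (hB' : MeasurableSet B')
    (hd : Disjoint B B') (c : ℂ) : L.e (B ∪ B') c = L.e B c + L.e B' c := by
  apply Lp.ext
  filter_upwards [L.e_coe hB c, L.e_coe hB' c, L.e_coe (hB.union hB') c,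
    Lp.coeFn_add (L.e B c) (L.e B' c)] with x h1 h2 h3 h4
  rw [h4, Pi.add_apply, h1, h2, h3, Set.indicator_union_of_disjoint hd]

lemma e_disj {B B' : Set X} (hB : MeasurableSet B) (hB' : MeasurableSet B')
    (hd : Disjoint B B') (c c' : ℂ) : ∀ᵐ x ∂μ, L.e B c x * L.e B' c' x = 0 := by
  filter_upwards [L.e_coe hB c, L.e_coe hB' c'] with x h1 h2
  rw [h1, h2]
  by_cases hx : x ∈ B
  · have : x ∉ B' := Set.disjoint_left.mp hd hx
    simp [this]
  · simp [hx]

lemma e_smul {B : Set X} (hB : MeasurableSet B) (c : ℂ) :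
    L.e B c = c.re • L.e B 1 + c.im • L.e B Complex.I := by
  apply Lp.ext
  filter_upwards [L.e_coe hB c, L.e_coe hB 1, L.e_coe hB Complex.I,
    Lp.coeFn_add (c.re • L.e B 1) (c.im • L.e B Complex.I),
    Lp.coeFn_smul c.re (L.e B 1), Lp.coeFn_smul c.im (L.e B Complex.I)] with x h1 h2 h3 h4 h5 h6
  rw [h4, Pi.add_apply, h5, h6, Pi.smul_apply, Pi.smul_apply, h1, h2, h3]
  by_cases hx : x ∈ B
  · simp only [hx, Set.indicator_of_mem, Complex.real_smul]
    conv_lhs => rw [← Complex.re_add_im c]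
    ring
  · simp [hx]

noncomputable def v : Lp ℂ (ENNReal.ofReal p) μ := L.T (L.e Set.univ 1)
noncomputable def w : Lp ℂ (ENNReal.ofReal p) μ := L.T (L.e Set.univ Complex.I)
noncomputable def Θ (B : Set X) : Set X := {x | L.T (L.e B 1) x ≠ 0}

lemma Lp_meas (f : Lp ℂ (ENNReal.ofReal p) μ) : Measurable f := (Lp.stronglyMeasurable f).measurable

lemma Θ_meas (B : Set X) : MeasurableSet (L.Θ B) :=
  (measurableSet_eq_fun (Lp_meas _) measurable_const).compl

lemma eq_zero_of_iso (f : Lp ℂ (ENNReal.ofReal p) μ) (h : (L.T' f : X → ℂ) =ᵐ[μ] 0) :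
    (f : X → ℂ) =ᵐ[μ] 0 := by
  rw [← NN_eq_zero L.hp (Lp.memLp _).1] at h ⊢
  rw [← h, L.hT'.iso]

lemma v_ne : ∀ᵐ x ∂μ, L.v x ≠ 0 := by
  set Z : Set X := {x | L.v x = 0} with hZ
  have hZm : MeasurableSet Z := measurableSet_eq_fun (Lp_meas _) measurable_const
  have h1 : ∀ᵐ x ∂μ, L.e Z 1 x * L.v x = 0 := by
    filter_upwards [L.e_coe hZm 1] with x hx
    rw [hx]
    by_cases h : x ∈ Z
    · have : L.v x = 0 := h
      rw [this, mul_zero]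
    · simp [h]
  have h2 := L.hT'.disj L.hp L.hp2 h1
  rw [v, L.left] at h2
  have h3 : (L.T' (L.e Z 1) : X → ℂ) =ᵐ[μ] 0 := by
    filter_upwards [h2, L.e_coe MeasurableSet.univ 1] with x h4 h5
    rw [h5] at h4
    have := (L.pos x).ne'
    simpa [this] using h4
  have h4 := L.eq_zero_of_iso _ h3
  filter_upwards [h4, L.e_coe hZm 1] with x h5 h6 h7
  rw [h6] at h5
  have hx : x ∈ Z := h7
  have := (L.pos x).ne'
  simp [hx, this] at h5

lemma T_add_compl {B : Set X} (hB : MeasurableSet B) (c : ℂ) :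
    ∀ᵐ x ∂μ, L.T (L.e B c) x + L.T (L.e Bᶜ c) x = L.T (L.e Set.univ c) x := by
  have h := L.e_union hB hB.compl disjoint_compl_right c
  rw [Set.union_compl_self] at h
  rw [h, L.hT.add]
  filter_upwards [Lp.coeFn_add (L.T (L.e B c)) (L.T (L.e Bᶜ c))] with x hx
  rw [hx]; rfl

lemma T_disj {B B' : Set X} (hB : MeasurableSet B) (hB' : MeasurableSet B')
    (hd : Disjoint B B') (c c' : ℂ) : ∀ᵐ x ∂μ, L.T (L.e B c) x * L.T (L.e B' c') x = 0 :=
  L.hT.disj L.hp L.hp2 (L.e_disj hB hB' hd c c')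

lemma T_e_one {B : Set X} (hB : MeasurableSet B) :
    L.T (L.e B 1) =ᵐ[μ] (L.Θ B).indicator L.v := by
  filter_upwards [L.T_add_compl hB 1, L.T_disj hB hB.compl disjoint_compl_right 1 1] with x h1 h2
  by_cases hx : x ∈ L.Θ B
  · have h0 : L.T (L.e B 1) x ≠ 0 := hx
    rw [Set.indicator_of_mem hx, v, ← h1, (mul_eq_zero.mp h2).resolve_left h0, add_zero]
  · rw [Set.indicator_of_notMem hx]
    by_contra h; exact hx h

lemma T_e_I {B : Set X} (hB : MeasurableSet B) :
    L.T (L.e B Complex.I) =ᵐ[μ] (L.Θ B).indicator L.w := by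
  filter_upwards [L.T_add_compl hB 1, L.T_add_compl hB Complex.I, L.v_ne,
    L.T_disj hB hB.compl disjoint_compl_right 1 Complex.I,
    L.T_disj hB hB.compl disjoint_compl_right Complex.I 1] with x h1 h2 h3 h4 h5
  by_cases hx : x ∈ L.Θ B
  · have h0 : L.T (L.e B 1) x ≠ 0 := hx
    rw [Set.indicator_of_mem hx, w, ← h2, (mul_eq_zero.mp h4).resolve_left h0, add_zero]
  · rw [Set.indicator_of_notMem hx]
    have h0 : L.T (L.e B 1) x = 0 := by
      by_contra h; exact hx h
    rw [h0, zero_add] at h1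
    have h6 : L.T (L.e Bᶜ 1) x ≠ 0 := by rw [h1]; exact h3
    exact (mul_eq_zero.mp h5).resolve_right h6

lemma T_e {B : Set X} (hB : MeasurableSet B) (c : ℂ) :
    L.T (L.e B c) =ᵐ[μ] (L.Θ B).indicator (fun x => (c.re : ℂ) * L.v x + c.im * L.w x) := by
  rw [L.e_smul hB, L.hT.add, L.hT.smul, L.hT.smul]
  filter_upwards [L.T_e_one hB, L.T_e_I hB,
    Lp.coeFn_add (c.re • L.T (L.e B 1)) (c.im • L.T (L.e B Complex.I)),
    Lp.coeFn_smul c.re (L.T (L.e B 1)), Lp.coeFn_smul c.im (L.T (L.e B Complex.I))]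
    with x h2 h3 h4 h5 h6
  rw [h4, Pi.add_apply, h5, h6, Pi.smul_apply, Pi.smul_apply, h2, h3]
  by_cases hx : x ∈ L.Θ B
  · simp [hx]
  · simp [hx]

lemma Θ_compl {B : Set X} (hB : MeasurableSet B) : L.Θ Bᶜ =ᵐ[μ] (L.Θ B)ᶜ := by
  refine Filter.eventuallyEq_set.mpr ?_
  filter_upwards [L.T_add_compl hB 1, L.T_disj hB hB.compl disjoint_compl_right 1 1,
    L.v_ne] with x h1 h2 h3
  show L.T (L.e Bᶜ 1) x ≠ 0 ↔ ¬ (L.T (L.e B 1) x ≠ 0)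
  rw [not_not]
  constructor
  · intro h; exact (mul_eq_zero.mp h2).resolve_right h
  · intro h h'
    rw [h, h', add_zero] at h1
    exact h3 h1.symm

lemma Θ_mono {B B' : Set X} (hB : MeasurableSet B) (hB' : MeasurableSet B') (hs : B ⊆ B') :
    L.Θ B ≤ᵐ[μ] L.Θ B' := by
  have e := L.e_union hB (hB'.diff hB) Set.disjoint_sdiff_right 1
  rw [Set.union_sdiff_cancel hs] at e
  filter_upwards [L.T_disj hB (hB'.diff hB) Set.disjoint_sdiff_right 1 1,
    Lp.coeFn_add (L.T (L.e B 1)) (L.T (L.e (B' \ B) 1))] with x h1 h2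
  intro hx
  have h0 : L.T (L.e B 1) x ≠ 0 := hx
  show L.T (L.e B' 1) x ≠ 0
  rw [e, L.hT.add, h2, Pi.add_apply, (mul_eq_zero.mp h1).resolve_left h0, add_zero]
  exact h0

/-- image density measure -/
noncomputable def m : Measure X := μ.withDensity fun x => ‖L.v x‖ₑ ^ p
/-- source density measure -/
noncomputable def m0 : Measure X := μ.withDensity fun x => ‖(L.h x : ℂ)‖ₑ ^ p

lemma meas_dens (f : X → ℂ) (hf : Measurable f) : Measurable fun x => ‖f x‖ₑ ^ p := by fun_prop

lemma hm' : Measurable fun x => (L.h x : ℂ) := Complex.measurable_ofReal.comp L.hm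

lemma m_ac : L.m ≪ μ := withDensity_absolutelyContinuous _ _

lemma ac_m : μ ≪ L.m := by
  refine withDensity_absolutelyContinuous' (meas_dens _ (Lp_meas _)).aemeasurable ?_
  filter_upwards [L.v_ne] with x hx
  simp [hx]

lemma ac_m0 : μ ≪ L.m0 := by
  refine withDensity_absolutelyContinuous' (meas_dens _ L.hm').aemeasurable ?_
  filter_upwards with x
  have := (L.pos x).ne'
  simp [this]

lemma setL_e {B : Set X} (hB : MeasurableSet B) (c : ℂ) :
    NN μ p (L.e B c) = ‖c‖ₑ ^ p * L.m0 B := by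
  rw [NN_congr (L.e_coe hB c), m0, withDensity_apply _ hB,
    ← lintegral_const_mul' _ _ (ENNReal.rpow_ne_top_of_nonneg L.hp.le (by simp)),
    ← lintegral_indicator hB]
  unfold NN
  congr 1; ext x
  by_cases hx : x ∈ B
  · simp only [hx, Set.indicator_of_mem, enorm_mul]
    rw [ENNReal.mul_rpow_of_nonneg _ _ L.hp.le]
  · simp [hx, L.hp]

lemma setL_T {B : Set X} (hB : MeasurableSet B) (c : ℂ) :
    ∫⁻ x in L.Θ B, ‖(c.re : ℂ) * L.v x + c.im * L.w x‖ₑ ^ p ∂μ = ‖c‖ₑ ^ p * L.m0 B := by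
  rw [← L.setL_e hB, ← L.hT.iso, NN_congr (L.T_e hB c), ← lintegral_indicator (L.Θ_meas B)]
  unfold NN
  congr 1; ext x
  by_cases hx : x ∈ L.Θ B
  · simp [hx]
  · simp [hx, L.hp]

lemma m_Θ {B : Set X} (hB : MeasurableSet B) : L.m (L.Θ B) = L.m0 B := by
  have := L.setL_T hB 1
  rw [m, withDensity_apply _ (L.Θ_meas B)]
  simpa using this

lemma m0_ne_top (B : Set X) : L.m0 B ≠ ⊤ := by
  refine ((measure_mono (Set.subset_univ B)).trans_lt ?_).ne
  rw [m0, withDensity_apply _ MeasurableSet.univ, Measure.restrict_univ]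
  exact ((memLp_iff_NN L.hp).mp L.memLp).2

lemma Θ_iUnion_disj (B : ℕ → Set X) (hB : ∀ n, MeasurableSet (B n))
    (hd : Pairwise (Function.onFun Disjoint B)) : L.Θ (⋃ n, B n) =ᵐ[μ] ⋃ n, L.Θ (B n) := by
  have hU := MeasurableSet.iUnion hB
  have hle : (⋃ n, L.Θ (B n) : Set X) ≤ᵐ[μ] L.Θ (⋃ n, B n) := by
    have := ae_all_iff.mpr fun n => L.Θ_mono (hB n) hU (Set.subset_iUnion B n)
    filter_upwards [this] with x hx h
    obtain ⟨n, hn⟩ := Set.mem_iUnion.mp h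
    exact hx n hn
  refine Filter.EventuallyEq.symm (L.ac_m.ae_eq ?_)
  refine ae_eq_of_ae_subset_of_measure_ge (L.m_ac.ae_le hle) ?_
    (MeasurableSet.iUnion fun n => L.Θ_meas _).nullMeasurableSet ?_
  · rw [L.m_Θ hU, measure_iUnion hd hB, measure_iUnion₀]
    · simp_rw [L.m_Θ (hB _)]; exact le_rfl
    · intro i j hij
      refine L.m_ac ?_
      have := L.T_disj (hB i) (hB j) (hd hij) 1 1
      refine measure_mono_null ?_ (ae_iff.mp this)
      rintro x ⟨h1, h2⟩
      exact mul_ne_zero h1 h2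
    · exact fun n => (L.Θ_meas _).nullMeasurableSet
  · rw [L.m_Θ hU]; exact L.m0_ne_top _

lemma Θ_iUnion (B : ℕ → Set X) (hB : ∀ n, MeasurableSet (B n)) :
    L.Θ (⋃ n, B n) =ᵐ[μ] ⋃ n, L.Θ (B n) := by
  have hU := MeasurableSet.iUnion hB
  have hdm : ∀ n, MeasurableSet (disjointed B n) := fun n => MeasurableSet.disjointed hB n
  have h1 := L.Θ_iUnion_disj _ hdm (disjoint_disjointed B)
  rw [iUnion_disjointed] at h1
  have h2 := ae_all_iff.mpr fun n => L.Θ_mono (hB n) hU (Set.subset_iUnion B n)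
  have h3 := ae_all_iff.mpr fun n => L.Θ_mono (hdm n) (hB n) (disjointed_subset B n)
  have h1 := Filter.eventuallyEq_set.mp h1
  refine Filter.eventuallyEq_set.mpr ?_
  filter_upwards [h1, h2, h3] with x a1 a2 a3
  constructor
  · intro h
    obtain ⟨n, hn⟩ := Set.mem_iUnion.mp (a1.mp h)
    exact Set.mem_iUnion.mpr ⟨n, a3 n hn⟩
  · intro h
    obtain ⟨n, hn⟩ := Set.mem_iUnion.mp h
    exact a2 n hn

lemma Θ_surj {A : Set X} (hA : MeasurableSet A) : ∃ B, MeasurableSet B ∧ L.Θ B =ᵐ[μ] A := by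
  have hmem : ∀ C : Set X, MeasurableSet C → MemLp (C.indicator L.v) (ENNReal.ofReal p) μ :=
    fun C hC => (Lp.memLp L.v).indicator hC
  set a := (hmem A hA).toLp
  set b := (hmem Aᶜ hA.compl).toLp
  have ha : a =ᵐ[μ] A.indicator L.v := MemLp.coeFn_toLp _
  have hb : b =ᵐ[μ] Aᶜ.indicator L.v := MemLp.coeFn_toLp _
  have hab : a + b = L.v := by
    apply Lp.ext
    filter_upwards [ha, hb, Lp.coeFn_add a b] with x h1 h2 h3
    rw [h3, Pi.add_apply, h1, h2]
    by_cases hx : x ∈ A <;> simp [hx]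
  have hd : ∀ᵐ x ∂μ, a x * b x = 0 := by
    filter_upwards [ha, hb] with x h1 h2
    rw [h1, h2]
    by_cases hx : x ∈ A <;> simp [hx]
  have hd' := L.hT'.disj L.hp L.hp2 hd
  have hab' : L.T' a + L.T' b = L.e Set.univ 1 := by
    rw [← L.hT'.add, hab, v, L.left]
  set B : Set X := {x | L.T' a x ≠ 0} with hBdef
  have hB : MeasurableSet B := (measurableSet_eq_fun (Lp_meas _) measurable_const).compl
  have he : L.e B 1 = L.T' a := by
    apply Lp.ext
    have h3 := Lp.coeFn_add (L.T' a) (L.T' b)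
    rw [hab'] at h3
    filter_upwards [L.e_coe hB 1, hd', h3, L.e_coe MeasurableSet.univ 1] with x h1 h2 h3 h4
    rw [h1]
    rw [h4] at h3
    by_cases hx : x ∈ B
    · have h0 : L.T' a x ≠ 0 := hx
      rw [Pi.add_apply, (mul_eq_zero.mp h2).resolve_left h0, add_zero] at h3
      rw [← h3]; simp [hx]
    · rw [Set.indicator_of_notMem hx]
      by_contra h; exact hx (fun h' => h h'.symm)
  refine ⟨B, hB, ?_⟩
  refine Filter.eventuallyEq_set.mpr ?_
  filter_upwards [ha, L.v_ne] with x h1 h2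
  simp only [Θ, he, L.right, Set.mem_ofPred_eq]
  rw [h1]
  by_cases hx : x ∈ A <;> simp [hx, h2]

lemma comb_norm [SigmaFinite μ] (c : ℂ) :
    ∀ᵐ x ∂μ, ‖(c.re : ℂ) * L.v x + c.im * L.w x‖ₑ ^ p = ‖c‖ₑ ^ p * ‖L.v x‖ₑ ^ p := by
  have hv := Lp_meas L.v
  have hw := Lp_meas L.w
  refine ae_eq_of_forall_setLIntegral_eq_of_sigmaFinite (by fun_prop) (by fun_prop) ?_
  intro A hA _
  obtain ⟨B, hB, hBA⟩ := L.Θ_surj hA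
  rw [← Measure.restrict_congr_set hBA, L.setL_T hB, ← L.m_Θ hB,
    lintegral_const_mul' _ _ (ENNReal.rpow_ne_top_of_nonneg L.hp.le (by simp)), m,
    withDensity_apply _ (L.Θ_meas B)]

lemma comb_norm' [SigmaFinite μ] (c : ℂ) :
    ∀ᵐ x ∂μ, ‖(c.re : ℂ) * L.v x + c.im * L.w x‖ = ‖c‖ * ‖L.v x‖ := by
  filter_upwards [L.comb_norm c] with x hx
  rw [← ENNReal.mul_rpow_of_nonneg _ _ L.hp.le, ← enorm_mul] at hx
  have h1 := ENNReal.rpow_left_injective L.hp.ne' hx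
  rw [← ofReal_norm, ← ofReal_norm, ENNReal.ofReal_eq_ofReal_iff (by positivity) (by positivity)] at h1
  rw [h1, norm_mul]

lemma vw [SigmaFinite μ] : ∀ᵐ x ∂μ, ‖L.w x‖ = ‖L.v x‖ ∧
    ((starRingEnd ℂ) (L.v x) * L.w x).re = 0 := by
  filter_upwards [L.comb_norm' Complex.I, L.comb_norm' (1 + Complex.I)] with x h1 h2
  simp at h1 h2
  refine ⟨h1, ?_⟩
  have h3 : ‖L.v x + L.w x‖ ^ 2 = ‖1 + Complex.I‖ ^ 2 * ‖L.v x‖ ^ 2 := by rw [h2]; ring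
  have h4 : ‖L.w x‖ ^ 2 = ‖L.v x‖ ^ 2 := by rw [h1]
  simp only [← Complex.normSq_eq_norm_sq, Complex.normSq_apply] at h3 h4
  simp at h3 h4 ⊢
  nlinarith

end Lam

open MeasureTheory ENNReal

lemma conf_cases {v w : ℂ} (h1 : ‖w‖ = ‖v‖) (h2 : ((starRingEnd ℂ) v * w).re = 0) :
    w = Complex.I * v ∨ w = -(Complex.I * v) := by
  have h4 : ‖w‖ ^ 2 = ‖v‖ ^ 2 := by rw [h1]
  simp only [← Complex.normSq_eq_norm_sq, Complex.normSq_apply] at h4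
  simp at h2
  obtain ⟨v1, v2⟩ := v
  obtain ⟨w1, w2⟩ := w
  simp only at h2 h4
  by_cases hD : v1 * v1 + v2 * v2 = 0
  · have a1 : v1 = 0 := by nlinarith [mul_self_nonneg v1, mul_self_nonneg v2]
    have a2 : v2 = 0 := by nlinarith [mul_self_nonneg v1, mul_self_nonneg v2]
    have a3 : w1 = 0 := by nlinarith [mul_self_nonneg w1, mul_self_nonneg w2]
    have a4 : w2 = 0 := by nlinarith [mul_self_nonneg w1, mul_self_nonneg w2]
    left
    subst a1 a2 a3 a4
    apply Complex.ext <;> simp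
  · have e : ((v1 * w2 - v2 * w1) - (v1 * v1 + v2 * v2)) *
        ((v1 * w2 - v2 * w1) + (v1 * v1 + v2 * v2)) = 0 := by
      linear_combination (v1 * v1 + v2 * v2) * h4 - (v1 * w1 + v2 * w2) * h2
    rcases mul_eq_zero.mp e with e | e
    · left
      apply Complex.ext
      · simp
        apply mul_right_cancel₀ hD
        linear_combination (-v2) * e + v1 * h2
      · simp
        apply mul_right_cancel₀ hD
        linear_combination v1 * e + v2 * h2
    · right
      apply Complex.ext
      · simp
        apply mul_right_cancel₀ hD
        linear_combination (-v2) * e + v1 * h2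
      · simp
        apply mul_right_cancel₀ hD
        linear_combination v1 * e + v2 * h2

lemma conf_norm {v w : ℂ} (h1 : ‖w‖ = ‖v‖) (h2 : ((starRingEnd ℂ) v * w).re = 0) (z : ℂ) :
    ‖v * (z.re : ℂ) + w * (z.im : ℂ)‖ = ‖v‖ * ‖z‖ := by
  rcases conf_cases h1 h2 with h | h
  · have : v * (z.re : ℂ) + w * (z.im : ℂ) = v * z := by
      conv_rhs => rw [← Complex.re_add_im z]
      rw [h]; ring
    rw [this, norm_mul]
  · have : v * (z.re : ℂ) + w * (z.im : ℂ) = v * (starRingEnd ℂ) z := by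
      have hz : (starRingEnd ℂ) z = (z.re : ℂ) - (z.im : ℂ) * Complex.I := by
        apply Complex.ext <;> simp
      rw [hz, h]; ring
    rw [this, norm_mul, Complex.norm_conj]

lemma conf_norm' {v w : ℂ} (h1 : ‖w‖ = ‖v‖) (h2 : ((starRingEnd ℂ) v * w).re = 0) (ξ : ℂ) :
    ‖((((starRingEnd ℂ) ξ * v).re : ℝ) : ℂ) + ((((starRingEnd ℂ) ξ * w).re : ℝ) : ℂ) * Complex.I‖
      = ‖v‖ * ‖ξ‖ := by
  have : ‖((((starRingEnd ℂ) ξ * v).re : ℝ) : ℂ) + ((((starRingEnd ℂ) ξ * w).re : ℝ) : ℂ) * Complex.I‖ ^ 2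
      = (‖v‖ * ‖ξ‖) ^ 2 := by
    rw [mul_pow]
    simp only [← Complex.normSq_eq_norm_sq, Complex.normSq_apply]
    rcases conf_cases h1 h2 with h | h <;> rw [h] <;> simp <;> ring
  exact (pow_left_inj₀ (norm_nonneg _) (by positivity) two_ne_zero).mp this

namespace Lam
variable {X : Type*} [MeasurableSpace X] {μ : Measure X} {p : ℝ} (L : Lam μ p)

lemma NN_m0 {k : X → ℂ} (hk : Measurable k) : NN L.m0 p k = NN μ p (fun x => k x * L.h x) := by
  unfold NN
  rw [m0, lintegral_withDensity_eq_lintegral_mul _ (meas_dens _ L.hm') (by fun_prop)]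
  congr 1; ext x
  rw [Pi.mul_apply, enorm_mul, ENNReal.mul_rpow_of_nonneg _ _ L.hp.le, mul_comm]

/-- the weighted composition operator -/
noncomputable def R (φ : X → X) (k : X → ℂ) : X → ℂ := fun x =>
  L.v x * ((k (φ x)).re : ℂ) + L.w x * ((k (φ x)).im : ℂ)


lemma map_m {φ : X → X} (hφ : Measurable φ)
    (hΘ : ∀ B, MeasurableSet B → φ ⁻¹' B =ᵐ[μ] L.Θ B) : L.m.map φ = L.m0 := by
  ext B hB
  rw [Measure.map_apply hφ hB, measure_congr (L.m_ac.ae_eq (hΘ B hB)), L.m_Θ hB]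

lemma lint_m {φ : X → X} (hφ : Measurable φ)
    (hΘ : ∀ B, MeasurableSet B → φ ⁻¹' B =ᵐ[μ] L.Θ B) {Φ : X → ℝ≥0∞} (hΦ : Measurable Φ) :
    ∫⁻ x, ‖L.v x‖ₑ ^ p * Φ (φ x) ∂μ = ∫⁻ x, ‖(L.h x : ℂ)‖ₑ ^ p * Φ x ∂μ := by
  have h1 : ∫⁻ x, Φ x ∂L.m0 = ∫⁻ x, ‖(L.h x : ℂ)‖ₑ ^ p * Φ x ∂μ := by
    rw [m0, lintegral_withDensity_eq_lintegral_mul _ (meas_dens _ L.hm') hΦ]; rfl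
  rw [← h1, ← L.map_m hφ hΘ, lintegral_map hΦ hφ, m,
    lintegral_withDensity_eq_lintegral_mul _ (meas_dens _ (Lp_meas _))
      (show Measurable (fun x => Φ (φ x)) from hΦ.comp hφ)]
  rfl

lemma qmp {φ : X → X} (hφ : Measurable φ)
    (hΘ : ∀ B, MeasurableSet B → φ ⁻¹' B =ᵐ[μ] L.Θ B) : Measure.QuasiMeasurePreserving φ μ μ := by
  refine ⟨hφ, Measure.AbsolutelyContinuous.mk fun N hN h0 => ?_⟩
  rw [Measure.map_apply hφ hN]
  apply L.ac_m
  rw [← Measure.map_apply hφ hN, L.map_m hφ hΘ]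
  exact withDensity_absolutelyContinuous _ _ h0

lemma NN_R [SigmaFinite μ] {φ : X → X} (hφ : Measurable φ)
    (hΘ : ∀ B, MeasurableSet B → φ ⁻¹' B =ᵐ[μ] L.Θ B) {k : X → ℂ} (hk : Measurable k) :
    NN μ p (L.R φ k) = NN μ p (fun x => k x * L.h x) := by
  have h1 : NN μ p (L.R φ k) = ∫⁻ x, ‖L.v x‖ₑ ^ p * (fun y => ‖k y‖ₑ ^ p) (φ x) ∂μ := by
    unfold NN
    apply lintegral_congr_ae
    filter_upwards [L.vw] with x hx
    have := conf_norm hx.1 hx.2 (k (φ x))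
    simp only [R]
    rw [← ofReal_norm, this, ENNReal.ofReal_mul (norm_nonneg _), ofReal_norm, ofReal_norm,
      ENNReal.mul_rpow_of_nonneg _ _ L.hp.le]
  refine h1.trans ((L.lint_m hφ hΘ (Φ := fun y => ‖k y‖ₑ ^ p) (by fun_prop)).trans ?_)
  unfold NN
  congr 1; ext x
  rw [enorm_mul, ENNReal.mul_rpow_of_nonneg _ _ L.hp.le, mul_comm]

lemma R_sub {φ : X → X} (k k' : X → ℂ) : L.R φ (k - k') = L.R φ k - L.R φ k' := by
  ext x; simp [R]; ring

lemma R_add {φ : X → X} (k k' : X → ℂ) : L.R φ (k + k') = L.R φ k + L.R φ k' := by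
  ext x; simp [R]; ring

lemma R_meas {φ : X → X} (hφ : Measurable φ) {k : X → ℂ} (hk : Measurable k) :
    Measurable (L.R φ k) := by
  have hv := Lp_meas L.v
  have hw := Lp_meas L.w
  unfold R
  fun_prop

lemma T_eq [SigmaFinite μ] {φ : X → X} (hφ : Measurable φ)
    (hΘ : ∀ B, MeasurableSet B → φ ⁻¹' B =ᵐ[μ] L.Θ B) (f : Lp ℂ (ENNReal.ofReal p) μ) :
    L.T f =ᵐ[μ] L.R φ (fun x => f x / L.h x) := by
  have hhm := L.hm'
  have hfm := Lp_meas f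
  set k : X → ℂ := fun x => f x / L.h x with hk
  have hkm : Measurable k := by rw [hk]; exact hfm.div hhm
  have hkh : ∀ x, k x * L.h x = f x := fun x => by
    have : (L.h x : ℂ) ≠ 0 := by exact_mod_cast (L.pos x).ne'
    simp only [hk]; field_simp
  have hkL : MemLp k (ENNReal.ofReal p) L.m0 := by
    rw [memLp_iff_NN L.hp, L.NN_m0 hkm]
    refine ⟨hkm.aestronglyMeasurable, ?_⟩
    simp_rw [hkh]
    exact ((memLp_iff_NN L.hp).mp (Lp.memLp f)).2
  have dense : ∀ ε : ℝ≥0∞, ε ≠ 0 → ∃ k', eLpNorm (k - k') (ENNReal.ofReal p) L.m0 ≤ ε ∧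
      (Measurable k' ∧ ∃ F : Lp ℂ (ENNReal.ofReal p) μ,
        F =ᵐ[μ] (fun x => k' x * L.h x) ∧ L.T F =ᵐ[μ] L.R φ k') := by
    intro ε hε
    refine MemLp.induction_dense (μ := L.m0) (p := ENNReal.ofReal p) ENNReal.ofReal_ne_top
      _ ?_ ?_ ?_ hkL hε
    · intro c s hs _ ε _
      refine ⟨s.indicator fun _ => c, by simp, measurable_const.indicator hs, L.e s c, ?_, ?_⟩
      · filter_upwards [L.e_coe hs c] with x hx
        rw [hx]
        by_cases h : x ∈ s <;> simp [h]
      · filter_upwards [L.T_e hs c, Filter.eventuallyEq_set.mp (hΘ s hs)] with x h1 h2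
        rw [h1]
        simp only [R]
        by_cases h : x ∈ L.Θ s
        · have h3 : φ x ∈ s := h2.mpr h
          simp [h, h3]; ring
        · have h3 : φ x ∉ s := fun h' => h (h2.mp h')
          simp [h, h3]
    · rintro k1 k2 ⟨a1, F1, b1, c1⟩ ⟨a2, F2, b2, c2⟩
      refine ⟨a1.add a2, F1 + F2, ?_, ?_⟩
      · filter_upwards [b1, b2, Lp.coeFn_add F1 F2] with x h1 h2 h3
        rw [h3, Pi.add_apply, h1, h2, Pi.add_apply]; ring
      · rw [L.hT.add, R_add]
        exact (Lp.coeFn_add _ _).trans (c1.add c2)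
    · rintro k1 ⟨a1, _⟩
      exact a1.aestronglyMeasurable
  have hz : NN μ p (⇑(L.T f) - L.R φ k) = 0 := by
    refine nonpos_iff_eq_zero.mp (ENNReal.le_of_forall_pos_le_add fun ε hε _ => ?_)
    rw [zero_add]
    have hε' : (ε : ℝ≥0∞) ≠ 0 := by exact_mod_cast hε.ne'
    set C : ℝ≥0∞ := 2 ^ p * 2 with hC
    have hCt : C ≠ ⊤ := ENNReal.mul_ne_top (ENNReal.rpow_ne_top_of_nonneg L.hp.le (by simp)) (by simp)
    have hC0 : C ≠ 0 := mul_ne_zero (ENNReal.rpow_pos (by simp) (by simp)).ne' (by simp)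
    have hδ : 0 < (ε : ℝ≥0∞) / C := ENNReal.div_pos hε' hCt
    obtain ⟨k', h1, h2, F, h3, h4⟩ := dense (((ε : ℝ≥0∞) / C) ^ (1 / p))
      (ENNReal.rpow_pos_of_nonneg hδ (by have := L.hp; positivity)).ne'
    have h5 := NN_le_of_eLpNorm L.hp h1
    rw [← ENNReal.rpow_mul, one_div, inv_mul_cancel₀ L.hp.ne', ENNReal.rpow_one,
      L.NN_m0 (hkm.sub h2)] at h5
    have h6 : NN μ p (⇑(L.T f) - ⇑(L.T F)) ≤ (ε : ℝ≥0∞) / C := by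
      rw [← NN_congr (Lp.coeFn_sub _ _), ← L.hT.sub, L.hT.iso, NN_congr (Lp.coeFn_sub _ _)]
      refine le_trans (le_of_eq (NN_congr ?_)) h5
      filter_upwards [h3] with x hx
      rw [Pi.sub_apply, hx, ← hkh x, Pi.sub_apply]; ring
    have h7 : NN μ p (⇑(L.T F) - L.R φ k) ≤ (ε : ℝ≥0∞) / C := by
      refine le_trans (le_of_eq ?_) h5
      rw [← L.NN_R hφ hΘ (hkm.sub h2), R_sub, NN_sub_comm]
      exact NN_congr (Filter.EventuallyEq.rfl.sub h4)
    calc NN μ p (⇑(L.T f) - L.R φ k)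
        ≤ 2 ^ p * (NN μ p (⇑(L.T f) - ⇑(L.T F)) + NN μ p (⇑(L.T F) - L.R φ k)) :=
          NN_sub_le L.hp (Lp.memLp _).1 (Lp.memLp _).1
      _ ≤ 2 ^ p * ((ε : ℝ≥0∞) / C + (ε : ℝ≥0∞) / C) := by gcongr
      _ = (ε : ℝ≥0∞) / C * C := by rw [hC]; ring
      _ = ε := ENNReal.div_mul_cancel hC0 hCt
  rw [NN_eq_zero L.hp ((Lp.memLp _).1.sub (L.R_meas hφ hkm).aestronglyMeasurable)] at hz
  filter_upwards [hz] with x hx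
  exact sub_eq_zero.mp hx

theorem lamperti [StandardBorelSpace X] [Nonempty X] [SigmaFinite μ] :
    ∃ (φ : X → X) (V W : X → ℂ), Measurable φ ∧ Measurable V ∧ Measurable W ∧
      (∀ᵐ x ∂μ, V x ≠ 0) ∧
      (∀ᵐ x ∂μ, ‖W x‖ = ‖V x‖ ∧ ((starRingEnd ℂ) (V x) * W x).re = 0) ∧
      (∀ Φ : X → ℝ≥0∞, Measurable Φ → ∫⁻ x, ‖V x‖ₑ ^ p * Φ (φ x) ∂μ = ∫⁻ x, Φ x ∂μ) ∧
      (∀ f, L.T f =ᵐ[μ] fun x => V x * ((f (φ x)).re : ℂ) + W x * ((f (φ x)).im : ℂ)) := by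
  obtain ⟨φ, hφ, hΘ⟩ := point_realization L.Θ (fun B _ => L.Θ_meas B) (fun B => L.Θ_compl) L.Θ_iUnion
  have hhm := L.hm'
  have hv := Lp_meas L.v
  have hw := Lp_meas L.w
  have hne : ∀ x, (L.h x : ℂ) ≠ 0 := fun x => by exact_mod_cast (L.pos x).ne'
  refine ⟨φ, fun x => L.v x / L.h (φ x), fun x => L.w x / L.h (φ x), hφ,
    hv.div (hhm.comp hφ), hw.div (hhm.comp hφ), ?_, ?_, ?_, ?_⟩
  · filter_upwards [L.v_ne] with x hx
    exact div_ne_zero hx (hne _)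
  · filter_upwards [L.vw] with x hx
    refine ⟨by rw [norm_div, norm_div, hx.1], ?_⟩
    rw [map_div₀, Complex.conj_ofReal, div_mul_div_comm, ← Complex.ofReal_mul,
      Complex.div_ofReal_re, hx.2, zero_div]
  · intro Φ hΦ
    have hm1 : Measurable fun x => Φ x / ‖(L.h x : ℂ)‖ₑ ^ p := by fun_prop
    have h0 : ∀ x, ‖(L.h x : ℂ)‖ₑ ^ p ≠ 0 := fun x => by
      have := L.pos x
      simp [this.ne', L.hp.le]
    have ht : ∀ x, ‖(L.h x : ℂ)‖ₑ ^ p ≠ ⊤ := fun x =>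
      ENNReal.rpow_ne_top_of_nonneg L.hp.le (by simp)
    have h1 := L.lint_m hφ hΘ hm1
    have e2 : ∫⁻ x, ‖(L.h x : ℂ)‖ₑ ^ p * (Φ x / ‖(L.h x : ℂ)‖ₑ ^ p) ∂μ = ∫⁻ x, Φ x ∂μ := by
      congr 1; ext x; exact ENNReal.mul_div_cancel (h0 x) (ht x)
    rw [e2] at h1
    rw [← h1]
    congr 1; ext x
    have e3 : ‖L.v x / L.h (φ x)‖ₑ = ‖L.v x‖ₑ / ‖(L.h (φ x) : ℂ)‖ₑ := by
      rw [div_eq_mul_inv, enorm_mul, enorm_inv (hne _)]; rfl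
    rw [e3, ENNReal.div_rpow_of_nonneg _ _ L.hp.le, div_eq_mul_inv, div_eq_mul_inv]
    ring
  · intro f
    filter_upwards [L.T_eq hφ hΘ f] with x hx
    rw [hx]
    simp only [R]
    rw [Complex.div_ofReal_re, Complex.div_ofReal_im]
    push_cast
    ring

end Lam

open MeasureTheory ENNReal

/-- The unimodular function attached to a real function. -/
noncomputable def uexp (t : ℝ) : ℂ := Complex.exp (Complex.I * (t : ℂ))

lemma measurable_uexp : Measurable uexp := by unfold uexp; fun_prop

lemma uexp_norm (t : ℝ) : ‖uexp t‖ = 1 := by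
  rw [uexp, mul_comm]; exact Complex.norm_exp_ofReal_mul_I t

lemma uexp_add (s t : ℝ) : uexp (s + t) = uexp s * uexp t := by
  simp only [uexp, ← Complex.exp_add]; congr 1; push_cast; ring

lemma uexp_lim (t : ℝ) : Filter.Tendsto (fun n : ℕ => ((n : ℝ) + 1) *
    (Complex.log (uexp (((n : ℝ) + 1)⁻¹ * t))).im) Filter.atTop (nhds t) := by
  apply tendsto_const_nhds.congr'
  obtain ⟨N, hN⟩ := exists_nat_gt |t|
  filter_upwards [Filter.eventually_ge_atTop N] with n hn
  have h1 : |t| < (n : ℝ) + 1 := by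
    have : (N : ℝ) ≤ n := by exact_mod_cast hn
    linarith
  have h0 : (0 : ℝ) < (n : ℝ) + 1 := by positivity
  have h2 : |((n : ℝ) + 1)⁻¹ * t| < 1 := by
    rw [abs_mul, abs_of_pos (inv_pos.mpr h0), inv_mul_lt_iff₀ h0]; linarith
  have h3 := abs_lt.mp h2
  have hpi := Real.pi_gt_three
  rw [uexp, Complex.log_exp]
  · simp only [Complex.mul_im, Complex.I_re, Complex.I_im, Complex.ofReal_re, Complex.ofReal_im]
    field_simp; ring
  · simp only [Complex.mul_im, Complex.I_re, Complex.I_im, Complex.ofReal_re, Complex.ofReal_im]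
    linarith
  · simp only [Complex.mul_im, Complex.I_re, Complex.I_im, Complex.ofReal_re, Complex.ofReal_im]
    linarith

lemma uexp_ne {t : ℝ} (ht : t ≠ 0) : ∃ n : ℕ, uexp (((n : ℝ) + 1)⁻¹ * t) ≠ 1 := by
  by_contra! h
  have := uexp_lim t
  simp only [h, Complex.log_one, Complex.zero_im, mul_zero] at this
  exact ht (tendsto_nhds_unique this tendsto_const_nhds)

lemma measurable_of_uexp {Y : Type*} (m : MeasurableSpace Y) {u : Y → ℝ}
    (h : ∀ n : ℕ, Measurable[m] (fun y => uexp (((n : ℝ) + 1)⁻¹ * u y))) : Measurable[m] u := by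
  have : ∀ n : ℕ, Measurable[m] (fun y => ((n : ℝ) + 1) *
      (Complex.log (uexp (((n : ℝ) + 1)⁻¹ * u y))).im) := fun n =>
    ((Complex.measurable_im.comp (Complex.measurable_log.comp (h n))).const_mul _)
  exact measurable_of_tendsto_metrizable this (tendsto_pi_nhds.mpr fun y => uexp_lim (u y))

lemma kap_re_zero (p : ℝ) : kap p {z : ℂ | z.re = 0} = 0 := by
  apply kap_ac
  have h := Measure.addHaar_submodule (volume : Measure ℂ) (LinearMap.ker Complex.reLm) (by
    intro h
    have : (1 : ℂ) ∈ LinearMap.ker Complex.reLm := by rw [h]; trivial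
    simp at this)
  convert h using 2
  ext z; simp

lemma lintegral_uexp_kap (p q : ℝ) (hp : 0 < p) (hq : p < q) (a : ℂ) :
    ∫⁻ ξ, ‖uexp (((starRingEnd ℂ) ξ * a).re) - 1‖ₑ ^ q ∂(kap p) = ‖a‖ₑ ^ p * c0 p q :=
  lintegral_exp_kap p q hp hq a

section transfer
variable {G : Type*} [Group G] [TopologicalSpace G]
    {X : Type*} [MeasurableSpace X] {μ : Measure X} {p : ℝ}
    {α : AffineIsometricAction G μ p} {q : ℝ} {Y : Type*} [mY : MeasurableSpace Y]
    {ν : Measure Y} {Ψ : Lp ℂ (ENNReal.ofReal p) μ → Y → ℂ} {S : G → Y → Y}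

lemma Model.gen_transfer (M : Model α q ν Ψ S) {Z : Type*} [mZ : MeasurableSpace Z] {ν' : Measure Z}
    (e : Y → Z) (e' : Z → Y) (he : Measurable e) (hmp : MeasurePreserving e' ν' ν)
    (l : ∀ y, e' (e y) = y) (r : ∀ z, e (e' z) = z) :
    ∀ m : MeasurableSpace Z, m ≤ mZ →
      (∀ N, MeasurableSet[mZ] N → ν' N = 0 → MeasurableSet[m] N) →
    (∀ A, MeasurableSet[mZ] A → (∀ g, (e ∘ S g ∘ e') ⁻¹' A = A) → MeasurableSet[m] A) →
    (∀ f (F : Z → ℂ), Measurable[mZ] F → F =ᵐ[ν'] Ψ f ∘ e' → Measurable[m] F) → mZ ≤ m := by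
  have he' := hmp.measurable
  have l' : e' ∘ e = id := funext l
  have r' : e ∘ e' = id := funext r
  have hqm := hmp.quasiMeasurePreserving
  have hmeas : ∀ N, MeasurableSet N → ν N = 0 → ν' (e' ⁻¹' N) = 0 := fun N hN h0 => by
    rw [hmp.measure_preimage hN.nullMeasurableSet, h0]
  have hae : ∀ f (F : Y → ℂ), F =ᵐ[ν] Ψ f → F ∘ e' =ᵐ[ν'] Ψ f ∘ e' := fun f F h =>
    hqm.ae_eq_comp h
  have hc : ∀ F : Y → ℂ, Measurable F → Measurable (F ∘ e') := fun F hF => hF.comp he'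
  intro m hm h1 h2 h3 B hB
  have key : mY ≤ m.comap e := by
    apply M.gen
    · rintro _ ⟨C, hC, rfl⟩
      exact he (hm _ hC)
    · intro N hN h0
      refine ⟨e' ⁻¹' N, h1 _ (he' hN) (hmeas N hN h0), ?_⟩
      rw [← Set.preimage_comp, l']; rfl
    · intro A hA hS
      refine ⟨e' ⁻¹' A, h2 _ (he' hA) fun g => ?_, ?_⟩
      · rw [← Set.preimage_comp]
        have : e' ∘ e ∘ S g ∘ e' = S g ∘ e' := by
          rw [← Function.comp_assoc, l']; rfl
        rw [this, Set.preimage_comp, hS]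
      · rw [← Set.preimage_comp, l']; rfl
    · intro f F hF hFe
      have h5 : Measurable[m] (F ∘ e') := h3 f _ (hc F hF) (hae f F hFe)
      have h4 : F = (F ∘ e') ∘ e := by rw [Function.comp_assoc, l']; rfl
      rw [h4]
      intro C hC
      exact ⟨(F ∘ e') ⁻¹' C, h5 hC, rfl⟩
  obtain ⟨B', hB', h⟩ := key _ (he hB)
  have : B' = B := by
    have := congrArg (fun A => e' ⁻¹' A) h
    simpa only [← Set.preimage_comp, r', Set.preimage_id] using this
  rwa [← this]

lemma Model.transfer (M : Model α q ν Ψ S) {Z : Type*} [mZ : MeasurableSpace Z] (e : Y ≃ᵐ Z) :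
    Model α q (ν.map e) (fun f => Ψ f ∘ e.symm) (fun g => e ∘ S g ∘ e.symm) := by
  have hmp : MeasurePreserving e.symm (ν.map e) ν := by
    refine ⟨e.symm.measurable, ?_⟩
    rw [Measure.map_map e.symm.measurable e.measurable]; simp
  have hmp' : MeasurePreserving e ν (ν.map e) := ⟨e.measurable, rfl⟩
  constructor
  · exact fun f => (M.meas f).comp e.symm.measurable
  · exact fun f y => M.unim f _
  · intro f f'
    exact hmp.quasiMeasurePreserving.ae_eq_comp (M.add f f')
  · intro f
    rw [← M.norm f]
    unfold NN
    rw [lintegral_map_equiv]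
    simp
  · intro g
    exact hmp'.comp ((M.mp g).comp hmp)
  · intro g f
    have := hmp.quasiMeasurePreserving.ae_eq_comp (M.equiv g f)
    refine Filter.EventuallyEq.trans (Filter.Eventually.of_forall fun y => ?_) this
    simp
  · exact M.gen_transfer e e.symm e.measurable hmp (fun y => e.symm_apply_apply y)
      (fun y => e.apply_symm_apply y)
  · obtain ⟨f, hf⟩ := M.cover
    exact ⟨f, hmp.quasiMeasurePreserving.ae hf⟩

theorem Model.final [StandardBorelSpace Y] [SigmaFinite ν] (M : Model α q ν Ψ S) (hp : 0 < p)
    (hq : 0 < q) :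
    ∃ (Y : Type) (_ : MeasurableSpace Y) (ν : Measure Y),
      StandardBorelSpace Y ∧ SigmaFinite ν ∧
      ∃ β : AffineIsometricAction G ν q,
        ∀ g : G, pPow μ p ((α.act g 0 : X →ₘ[μ] ℂ)) = pPow ν q ((β.act g 0 : Y →ₘ[ν] ℂ)) := by
  obtain ⟨s, hs, ⟨e⟩⟩ := MeasureTheory.exists_subset_real_measurableEquiv Y
  have : StandardBorelSpace s := hs.standardBorel
  exact ⟨s, inferInstance, ν.map e, inferInstance, e.sigmaFinite_map,
    (M.transfer e).core hp hq⟩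

theorem trivial_final (h : ∀ g, pPow μ p ((α.act g 0 : X →ₘ[μ] ℂ)) = 0) :
    ∃ (Y : Type) (_ : MeasurableSpace Y) (ν : Measure Y),
      StandardBorelSpace Y ∧ SigmaFinite ν ∧
      ∃ β : AffineIsometricAction G ν q,
        ∀ g : G, pPow μ p ((α.act g 0 : X →ₘ[μ] ℂ)) = pPow ν q ((β.act g 0 : Y →ₘ[ν] ℂ)) := by
  refine ⟨Unit, inferInstance, 0, inferInstance, inferInstance,
    ⟨fun _ f => f, fun _ => rfl, fun _ _ _ => rfl, fun _ _ _ => rfl, fun _ _ _ _ => rfl, ?_⟩, ?_⟩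
  · intro f g
    simp [pPow]
  · intro g
    rw [h]; simp [pPow]
end transfer

open MeasureTheory ENNReal

lemma exists_weight {X : Type*} [MeasurableSpace X] (μ : Measure X) [SigmaFinite μ] {p : ℝ}
    (hp : 0 < p) : ∃ h : X → ℝ, Measurable h ∧ (∀ x, 0 < h x) ∧
      MemLp (fun x => (h x : ℂ)) (ENNReal.ofReal p) μ := by
  obtain ⟨g, g0, gm, gi⟩ := exists_pos_lintegral_lt_of_sigmaFinite μ one_ne_zero
  have hm : Measurable (fun x => (g x : ℝ) ^ p⁻¹) := by fun_prop
  have hpos : ∀ x, 0 < (g x : ℝ) ^ p⁻¹ := fun x => Real.rpow_pos_of_pos (by exact_mod_cast g0 x) _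
  refine ⟨fun x => (g x : ℝ) ^ p⁻¹, hm, hpos, ?_⟩
  rw [memLp_iff_NN hp]
  refine ⟨(Complex.measurable_ofReal.comp hm).aestronglyMeasurable, lt_of_eq_of_lt ?_
    (gi.trans ENNReal.one_lt_top)⟩
  unfold NN
  apply lintegral_congr
  intro x
  rw [← ofReal_norm, Complex.norm_real, Real.norm_eq_abs, abs_of_pos (hpos x),
    ENNReal.ofReal_rpow_of_pos (hpos x), ← Real.rpow_mul (by positivity), inv_mul_cancel₀ hp.ne',
    Real.rpow_one, ENNReal.ofReal_coe_nnreal]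

/-- the skew product transformation on `X × ℂ` -/
noncomputable def skew {X : Type*} (φ : X → X) (V W : X → ℂ) (y : X × ℂ) : X × ℂ :=
  (φ y.1, ((((starRingEnd ℂ) y.2 * V y.1).re : ℝ) : ℂ)
    + ((((starRingEnd ℂ) y.2 * W y.1).re : ℝ) : ℂ) * Complex.I)

/-- the fibre map of `skew` -/
noncomputable def fib (v w : ℂ) : ℂ →ₗ[ℝ] ℂ where
  toFun ξ := ((((starRingEnd ℂ) ξ * v).re : ℝ) : ℂ)
    + ((((starRingEnd ℂ) ξ * w).re : ℝ) : ℂ) * Complex.I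
  map_add' a b := by simp only [map_add, add_mul, Complex.add_re]; push_cast; ring
  map_smul' t a := by
    apply Complex.ext <;> simp <;> ring

section
variable {X : Type*} [MeasurableSpace X] {μ : Measure X} {p : ℝ}

lemma measurable_conj : Measurable (fun z : ℂ => (starRingEnd ℂ) z) :=
  Complex.continuous_conj.measurable

lemma measurable_skew {φ : X → X} {V W : X → ℂ} (hφ : Measurable φ) (hV : Measurable V)
    (hW : Measurable W) : Measurable (skew φ V W) := by
  have h1 : Measurable (fun y : X × ℂ => (starRingEnd ℂ) y.2) := measurable_conj.comp measurable_snd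
  have h2 : ∀ U : X → ℂ, Measurable U →
      Measurable (fun y : X × ℂ => ((((starRingEnd ℂ) y.2 * U y.1).re : ℝ) : ℂ)) := fun U hU =>
    Complex.measurable_ofReal.comp (Complex.measurable_re.comp (h1.mul (hU.comp measurable_fst)))
  exact (hφ.comp measurable_fst).prodMk ((h2 V hV).add ((h2 W hW).mul_const _))

lemma skew_mp [SigmaFinite μ] {φ : X → X} {V W : X → ℂ} (hφ : Measurable φ) (hV : Measurable V)
    (hW : Measurable W) (hV0 : ∀ᵐ x ∂μ, V x ≠ 0)
    (hVW : ∀ᵐ x ∂μ, ‖W x‖ = ‖V x‖ ∧ ((starRingEnd ℂ) (V x) * W x).re = 0)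
    (hΦ : ∀ Φ : X → ℝ≥0∞, Measurable Φ → ∫⁻ x, ‖V x‖ₑ ^ p * Φ (φ x) ∂μ = ∫⁻ x, Φ x ∂μ) :
    MeasurePreserving (skew φ V W) (μ.prod (kap p)) (μ.prod (kap p)) := by
  have hm := measurable_skew hφ hV hW
  refine ⟨hm, ?_⟩
  ext B hB
  rw [Measure.map_apply hm hB, Measure.prod_apply (hm hB), Measure.prod_apply hB,
    ← hΦ _ (measurable_measure_prodMk_left hB)]
  apply lintegral_congr_ae
  filter_upwards [hV0, hVW] with x h0 h1
  have hB' : MeasurableSet (Prod.mk (φ x) ⁻¹' B) := measurable_prodMk_left hB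
  have key := lintegral_kap_similarity p (fib (V x) (W x)) ‖V x‖ (norm_pos_iff.mpr h0)
    (fun ξ => conf_norm' h1.1 h1.2 ξ) ((Prod.mk (φ x) ⁻¹' B).indicator 1)
    (measurable_one.indicator hB')
  rw [lintegral_indicator_one hB'] at key
  rw [← ofReal_norm, ENNReal.ofReal_rpow_of_pos (norm_pos_iff.mpr h0), ← key,
    ← lintegral_indicator_one (measurable_prodMk_left (hm hB))]
  rfl

end

section
variable {G : Type*} [Group G] [TopologicalSpace G]
    {X : Type*} [MeasurableSpace X] {μ : Measure X} {p q : ℝ}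

/-- the phase -/
noncomputable def ph (f : X → ℂ) (y : X × ℂ) : ℝ := ((starRingEnd ℂ) y.2 * f y.1).re

lemma measurable_ph {f : X → ℂ} (hf : Measurable f) : Measurable (ph f) :=
  Complex.measurable_re.comp ((measurable_conj.comp measurable_snd).mul (hf.comp measurable_fst))

lemma ph_congr [SigmaFinite μ] {f f' : X → ℂ} (h : f =ᵐ[μ] f') (c : ℝ≥0∞) :
    ph f =ᵐ[c • μ.prod (kap p)] ph f' := by
  refine (Measure.smul_absolutelyContinuous (c := c)).ae_le ?_
  filter_upwards [Measure.quasiMeasurePreserving_fst.ae h] with y hy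
  simp only [ph, hy]

theorem model_ne_two [StandardBorelSpace X] [SigmaFinite μ] [Nonempty X] (hp : 0 < p) (hpq : p < q)
    (hp2 : p ≠ 2) (α : AffineIsometricAction G μ p) :
    ∃ S, Model α q ((c0 p q)⁻¹ • μ.prod (kap p)) (fun f y => uexp (ph f y)) S := by
  obtain ⟨h, hm, h0, hL⟩ := exists_weight μ hp
  let L : G → Lam μ p := fun g => 
    { T := linPart α g
      T' := linPart α g⁻¹
      hT := linPart_linIso α g
      hT' := linPart_linIso α g⁻¹
      left := fun f => by rw [← linPart_mul, inv_mul_cancel, linPart_one]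
      right := fun f => by rw [← linPart_mul, mul_inv_cancel, linPart_one]
      h := h, hm := hm, pos := h0, memLp := hL, hp := hp, hp2 := hp2 }
  choose φ V W hφ hV hW hV0 hVW hΦ hT using fun g => (L g).lamperti
  have hz : (μ.prod (kap p)) {y : X × ℂ | y.2.re = 0} = 0 := by
    have : {y : X × ℂ | y.2.re = 0} = Set.univ ×ˢ {z : ℂ | z.re = 0} := by ext y; simp
    rw [this, Measure.prod_prod, kap_re_zero, mul_zero]
  have hac : ((c0 p q)⁻¹ • μ.prod (kap p)) ≪ μ.prod (kap p) := Measure.smul_absolutelyContinuous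
  have hz' : ((c0 p q)⁻¹ • μ.prod (kap p)) {y : X × ℂ | y.2.re = 0} = 0 := hac hz
  have hsm : ∀ (n : ℕ) B c, MeasurableSet B → 
      (fun y => uexp (ph (((n : ℝ) + 1)⁻¹ • (L 1).e B c : Lp ℂ (ENNReal.ofReal p) μ) y))
      =ᵐ[(c0 p q)⁻¹ • μ.prod (kap p)]
      fun y => uexp (((n : ℝ) + 1)⁻¹ * ph (B.indicator fun x => c * h x) y) := by
    intro n B c hB
    have : ⇑(((n : ℝ) + 1)⁻¹ • (L 1).e B c : Lp ℂ (ENNReal.ofReal p) μ) =ᵐ[μ]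
        fun x => (((n : ℝ) + 1)⁻¹ : ℝ) • (B.indicator fun x => c * (h x : ℂ)) x := by
      filter_upwards [Lp.coeFn_smul (((n : ℝ) + 1)⁻¹) ((L 1).e B c), (L 1).e_coe hB c] with x h1 h2
      rw [h1, Pi.smul_apply, h2]
    filter_upwards [ph_congr this (c0 p q)⁻¹] with y hy
    rw [hy]
    congr 1
    simp only [ph, Complex.real_smul]
    rw [mul_left_comm, Complex.re_ofReal_mul]
  refine ⟨fun g => skew (φ g) (V g) (W g), ?_, ?_, ?_, ?_, ?_, ?_, ?_, ?_⟩
  · exact fun f => measurable_uexp.comp (measurable_ph (Lam.Lp_meas f))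
  · exact fun f y => uexp_norm _
  · intro f f'
    filter_upwards [ph_congr (Lp.coeFn_add f f') (c0 p q)⁻¹] with y hy
    rw [hy, Pi.mul_apply, ← uexp_add]
    simp [ph, mul_add]
  · intro f
    unfold NN
    rw [lintegral_smul_measure, lintegral_prod]
    · have : ∀ x, ∫⁻ ξ, ‖((fun y => uexp (ph f y)) - 1 : X × ℂ → ℂ) (x, ξ)‖ₑ ^ q ∂(kap p)
        = ‖f x‖ₑ ^ p * c0 p q := fun x => lintegral_uexp_kap p q hp hpq (f x)
      simp_rw [this]
      rw [lintegral_mul_const _ (by have := Lam.Lp_meas f; fun_prop), smul_eq_mul, mul_comm, mul_assoc,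
        ENNReal.mul_inv_cancel (c0_ne_zero p q hp hpq) (c0_ne_top p q hp hpq), mul_one]
    · have : Measurable (fun y => uexp (ph f y)) :=
        measurable_uexp.comp (measurable_ph (Lam.Lp_meas f))
      exact ((this.sub measurable_one).enorm.pow_const q).aemeasurable
  · intro g
    exact (skew_mp (hφ g) (hV g) (hW g) (hV0 g) (hVW g) (hΦ g)).smul_measure _
  · intro g f
    filter_upwards [ph_congr (hT g f) (c0 p q)⁻¹] with y hy
    have : (L g).T f = linPart α g f := rfl
    rw [this] at hy
    rw [hy]
    simp only [Function.comp]
    congr 1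
    simp only [ph, skew]
    simp
    ring
  · intro m hle hN _ hF
    have hu : ∀ B c, MeasurableSet B → Measurable[m] (ph (B.indicator fun x => c * h x)) := by
      intro B c hB
      refine measurable_of_uexp m fun n => hF _ _ ?_ (hsm n B c hB).symm
      have hmm : Measurable (B.indicator fun x => c * (h x : ℂ)) :=
        ((Complex.measurable_ofReal.comp hm).const_mul c).indicator hB
      exact measurable_uexp.comp ((measurable_ph hmm).const_mul _)
    have hfst : Measurable[m] (Prod.fst : X × ℂ → X) := by
      intro B hB
      have e1 : (Prod.fst ⁻¹' B : Set (X × ℂ)) =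
          {y | ph (B.indicator fun x => 1 * (h x : ℂ)) y ≠ 0} ∪ 
            ((Prod.fst ⁻¹' B) ∩ {y : X × ℂ | y.2.re = 0}) := by
        ext ⟨x, ξ⟩
        have := (h0 x).ne'
        by_cases hx : x ∈ B <;> by_cases hxi : ξ.re = 0 <;> simp [ph, hx, hxi, this]
      rw [e1]
      refine MeasurableSet.union ?_ (hN _ ?_ (measure_mono_null Set.inter_subset_right hz'))
      · exact hu B 1 hB (measurableSet_singleton 0).compl
      · exact (measurable_fst hB).inter
          ((Complex.measurable_re.comp measurable_snd) (measurableSet_singleton 0))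
    have hre : Measurable[m] (fun y : X × ℂ => y.2.re) := by
      have := (hu Set.univ 1 MeasurableSet.univ).div (hm.comp hfst)
      convert this using 1
      ext ⟨x, ξ⟩
      have := (h0 x).ne'
      simp [ph, this]
    have him : Measurable[m] (fun y : X × ℂ => y.2.im) := by
      have := (hu Set.univ Complex.I MeasurableSet.univ).div (hm.comp hfst)
      convert this using 1
      ext ⟨x, ξ⟩
      have := (h0 x).ne'
      simp [ph, this]
    have hsnd : Measurable[m] (Prod.snd : X × ℂ → ℂ) := by
      have := Complex.measurableEquivRealProd.symm.measurable.comp (hre.prodMk him)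
      exact this
    exact sup_le (measurable_iff_comap_le.mp hfst) (measurable_iff_comap_le.mp hsnd)
  · refine ⟨fun n => ((n : ℝ) + 1)⁻¹ • (L 1).e Set.univ 1, ?_⟩
    have hz2 : ∀ᵐ y ∂((c0 p q)⁻¹ • μ.prod (kap p)), ¬ (y.2.re = 0) := by
      rw [ae_iff]; simpa using hz'
    filter_upwards [hz2, ae_all_iff.mpr fun n => hsm n Set.univ 1 MeasurableSet.univ] with y h1 h2
    simp only [h2]
    apply uexp_ne
    simp [ph, h1, (h0 y.1).ne']
end

open MeasureTheory ENNReal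
open ProbabilityTheory in
/-- countable product of standard gaussians -/
noncomputable def gam (w : Type*) : Measure (w → ℝ) :=
  Measure.infinitePi (fun _ : w => gaussianReal 0 1)

instance (w : Type*) : IsProbabilityMeasure (gam w) := by unfold gam; infer_instance

section gauss
open ProbabilityTheory
variable {w : Type*}

lemma gam_eval (i : w) : (gam w).map (fun x => x i) = gaussianReal 0 1 :=
  Measure.infinitePi_map_eval (fun _ : w => gaussianReal 0 1) i

lemma gam_mp (i : w) : MeasurePreserving (fun x : w → ℝ => x i) (gam w) (gaussianReal 0 1) :=
  ⟨measurable_pi_apply i, gam_eval i⟩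

lemma gam_indep : iIndepFun (fun (i : w) (x : w → ℝ) => x i) (gam w) :=
  iIndepFun_infinitePi (P := fun _ : w => gaussianReal 0 1) (X := fun _ x => x) (fun _ => measurable_id)

lemma eval_memLp (i : w) : MemLp (fun x : w → ℝ => x i) 2 (gam w) :=
  (memLp_id_gaussianReal' (μ := 0) (v := 1) 2 (by simp)).comp_measurePreserving (gam_mp i)

/-- coordinates as elements of `L²` -/
noncomputable def coor (i : w) : Lp ℝ 2 (gam w) := (eval_memLp i).toLp

lemma coor_coe (i : w) : coor i =ᵐ[gam w] fun x => x i := MemLp.coeFn_toLp _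

lemma coor_orthonormal : Orthonormal ℝ (coor : w → Lp ℝ 2 (gam w)) := by
  have hsq : ∀ i : w, ∫ x, x i * x i ∂(gam w) = 1 := by
    intro i
    have h1 := (gam_mp i).map_eq
    have h2 : ∫ x, x i * x i ∂(gam w) = ∫ y, y * y ∂(gaussianReal 0 1) := by
      rw [← h1, integral_map (measurable_pi_apply i).aemeasurable
        (by fun_prop)]
    rw [h2]
    have h3 : Var[fun x ↦ x; gaussianReal 0 1] = ((1 : NNReal) : ℝ) := variance_fun_id_gaussianReal
    rw [variance_eq_integral (by fun_prop)] at h3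
    simp only [integral_id_gaussianReal, sub_zero] at h3
    simpa [pow_two] using h3
  classical
  rw [orthonormal_iff_ite]
  intro i j
  have e : inner ℝ (coor i) (coor j) = ∫ x, x i * x j ∂(gam w) := by
    rw [L2.inner_def]
    apply integral_congr_ae
    filter_upwards [coor_coe i, coor_coe j] with x h1 h2
    rw [h1, h2]; simp [mul_comm]
  rw [e]
  split_ifs with h
  · subst h; exact hsq i
  · have h1 := (gam_indep (w := w)).indepFun h
    have h2 := h1.integral_fun_mul_eq_mul_integral (measurable_pi_apply i).aestronglyMeasurable
      (measurable_pi_apply j).aestronglyMeasurable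
    rw [h2]
    have : ∫ x, x i ∂(gam w) = 0 := by
      have h4 : ∫ x, x i ∂(gam w) = ∫ y, y ∂(gaussianReal 0 1) := by
        rw [← (gam_mp i).map_eq, integral_map (measurable_pi_apply i).aemeasurable (by fun_prop)]
      rw [h4, integral_id_gaussianReal]
    rw [this, zero_mul]

/-- characteristic functional -/
noncomputable def chf (k : Lp ℝ 2 (gam w)) : ℂ := ∫ x, uexp (k x) ∂(gam w)

lemma uexp_sub_le (s t : ℝ) : ‖uexp s - uexp t‖ ≤ |s - t| := by
  have h : uexp s - uexp t = uexp t * (uexp (s - t) - 1) := by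
    rw [mul_sub, ← uexp_add]; simp
  rw [h, norm_mul, uexp_norm, one_mul]
  exact (norm_exp_sub_one_le (s - t)).trans (min_le_right _ _)

lemma Lp2_meas (k : Lp ℝ 2 (gam w)) : Measurable k := (Lp.stronglyMeasurable k).measurable

lemma uexp_integrable (k : Lp ℝ 2 (gam w)) : Integrable (fun x => uexp (k x)) (gam w) := by
  refine Integrable.of_bound (measurable_uexp.comp (Lp2_meas k)).aestronglyMeasurable 1 ?_
  exact Filter.Eventually.of_forall fun x => (uexp_norm _).le

lemma chf_lip (k k' : Lp ℝ 2 (gam w)) : ‖chf k - chf k'‖ ≤ ‖k - k'‖ := by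
  unfold chf
  rw [← integral_sub (uexp_integrable k) (uexp_integrable k')]
  have hL1 : MemLp (k - k' : Lp ℝ 2 (gam w)) 1 (gam w) :=
    (Lp.memLp (k - k')).mono_exponent (by norm_num)
  have hi : Integrable (k - k' : Lp ℝ 2 (gam w)) (gam w) := memLp_one_iff_integrable.mp hL1
  calc ‖∫ x, uexp (k x) - uexp (k' x) ∂(gam w)‖ ≤ ∫ x, ‖(k - k' : Lp ℝ 2 (gam w)) x‖ ∂(gam w) := by
        refine norm_integral_le_of_norm_le hi.norm ?_
        filter_upwards [Lp.coeFn_sub k k'] with x hx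
        rw [hx]
        exact uexp_sub_le _ _
    _ = (eLpNorm (k - k' : Lp ℝ 2 (gam w)) 1 (gam w)).toReal := by
        rw [eLpNorm_one_eq_lintegral_enorm, integral_norm_eq_lintegral_enorm hi.1]
    _ ≤ (eLpNorm (k - k' : Lp ℝ 2 (gam w)) 2 (gam w)).toReal := by
        refine ENNReal.toReal_mono (Lp.eLpNorm_ne_top _) ?_
        exact eLpNorm_le_eLpNorm_of_exponent_le (by norm_num) hi.1
    _ = ‖k - k'‖ := (Lp.norm_def _).symm

lemma chf_continuous : Continuous (chf : Lp ℝ 2 (gam w) → ℂ) := by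
  refine (LipschitzWith.of_dist_le_mul (K := 1) fun k k' => ?_).continuous
  rw [dist_eq_norm, dist_eq_norm, NNReal.coe_one, one_mul]
  exact chf_lip k k'

lemma charFun_uexp (P : Measure ℝ) (t : ℝ) : charFun P t = ∫ x, uexp (t * x) ∂P := by
  rw [charFun_apply_real]
  congr 1; ext x
  simp only [uexp]; congr 1; push_cast; ring

lemma coor_mul_meas (c : w → ℝ) (i : w) : Measurable (fun x : w → ℝ => c i * x i) := by
  have h : Measurable (fun x : w → ℝ => x i) := measurable_pi_apply i
  exact h.const_mul (c i)

lemma chf_coor (s : Finset w) (c : w → ℝ) :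
    chf (∑ i ∈ s, c i • coor i) = Complex.exp (-(∑ i ∈ s, (c i : ℂ) ^ 2) / 2) := by
  have h0 : ⇑(∑ i ∈ s, c i • coor i : Lp ℝ 2 (gam w)) =ᵐ[gam w] fun x => ∑ i ∈ s, c i * x i := by
    have h1 : ∀ i, ⇑(c i • coor i) =ᵐ[gam w] fun x => c i * x i := fun i => by
      filter_upwards [Lp.coeFn_smul (c i) (coor i), coor_coe i] with x h1 h2
      rw [h1, Pi.smul_apply, h2]; rfl
    classical
    induction s using Finset.induction_on with
    | empty => 
      filter_upwards [Lp.coeFn_zero ℝ 2 (gam w)] with x hx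
      simp only [Finset.sum_empty]; rw [hx]; rfl
    | insert a s ha ih =>
      rw [Finset.sum_insert ha]
      filter_upwards [Lp.coeFn_add (c a • coor a) (∑ i ∈ s, c i • coor i), ih, h1 a] with x a1 a2 a3
      rw [a1, Pi.add_apply, a2, a3, Finset.sum_insert ha]
  have h1 : chf (∑ i ∈ s, c i • coor i) = charFun ((gam w).map (fun x => ∑ i ∈ s, c i * x i)) 1 := by
    rw [charFun_uexp, integral_map (Finset.measurable_fun_sum _
      fun i _ => coor_mul_meas c i).aemeasurable (by
      exact (measurable_uexp.comp (measurable_const_mul 1)).aestronglyMeasurable)]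
    unfold chf
    apply integral_congr_ae
    filter_upwards [h0] with x hx
    rw [hx, one_mul]
  have hind : iIndepFun (fun (i : w) (x : w → ℝ) => c i * x i) (gam w) :=
    (gam_indep (w := w)).comp (fun i y => c i * y) (fun i => measurable_const_mul _)
  rw [h1, iIndepFun.charFun_map_fun_finsetSum_eq_prod 
    (fun i _ => (coor_mul_meas c i).aemeasurable) (hind.restrict _),
    Finset.prod_apply, neg_div, Finset.sum_div, ← Finset.sum_neg_distrib, Complex.exp_sum]
  apply Finset.prod_congr rfl
  intro i _
  have h2 : (gam w).map (fun x => c i * x i) = (gaussianReal 0 1).map (fun y => c i * y) := by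
    rw [← gam_eval i, Measure.map_map (by fun_prop) (by fun_prop)]; rfl
  rw [h2, charFun_map_mul, charFun_gaussianReal]
  congr 1
  push_cast; ring
end gauss

open MeasureTheory ENNReal

section gauss2
open ProbabilityTheory
variable {w : Type*} {E : Type*} [NormedAddCommGroup E] [InnerProductSpace ℝ E]
  (b : HilbertBasis w ℝ E)

/-- The isometric embedding in the Gaussian Hilbert space. -/
noncomputable def gemb : E →ₗᵢ[ℝ] Lp ℝ 2 (gam w) :=
  (coor_orthonormal (w := w)).orthogonalFamily.linearIsometry.comp b.repr.toLinearIsometry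

lemma gemb_b (i : w) : gemb b (b i) = coor i := by
  classical
  simp only [gemb, LinearIsometry.coe_comp, Function.comp, LinearIsometryEquiv.coe_toLinearIsometry,
    HilbertBasis.repr_self]
  rw [OrthogonalFamily.linearIsometry_apply_single]
  simp

lemma b_dense : Dense (Submodule.span ℝ (Set.range b) : Set E) :=
  Submodule.dense_iff_topologicalClosure_eq_top.mpr b.dense_span

lemma chf_gemb (f : E) : chf (gemb b f) = Complex.exp (-((‖f‖ : ℂ) ^ 2) / 2) := by
  have hcl : IsClosed {f : E | chf (gemb b f) = Complex.exp (-((‖f‖ : ℂ) ^ 2) / 2)} := by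
    refine isClosed_eq (chf_continuous.comp (gemb b).continuous) ?_
    fun_prop
  have hsub : (Submodule.span ℝ (Set.range b) : Set E) ⊆
      {f : E | chf (gemb b f) = Complex.exp (-((‖f‖ : ℂ) ^ 2) / 2)} := by
    intro f hf
    obtain ⟨c, rfl⟩ := (Finsupp.mem_span_range_iff_exists_finsupp).mp hf
    show chf (gemb b _) = _
    have e1 : gemb b (c.sum fun i a => a • b i) = ∑ i ∈ c.support, c i • coor i := by
      simp only [Finsupp.sum, map_sum, map_smul, gemb_b]
    have e2 : ‖c.sum fun i a => a • b i‖ ^ 2 = ∑ i ∈ c.support, (c i) ^ 2 := by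
      rw [← real_inner_self_eq_norm_sq, Finsupp.sum, b.orthonormal.inner_sum]
      simp [pow_two]
    rw [e1, chf_coor]
    have e3 := congrArg (fun x : ℝ => (x : ℂ)) e2
    push_cast at e3
    rw [e3]
  exact hcl.closure_subset_iff.mpr hsub (b_dense b f)

/-- second quantization of an isometry -/
noncomputable def quant (T : E → E) (x : w → ℝ) : w → ℝ := fun i => gemb b (T (b i)) x

lemma measurable_quant (T : E → E) : Measurable (quant b T) :=
  measurable_pi_iff.mpr fun _ => Lp2_meas _

lemma gemb_sum (T : E →ₗᵢ[ℝ] E) (s : Finset w) (c : w → ℝ) :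
    ∫ x, uexp (∑ i ∈ s, c i * gemb b (T (b i)) x) ∂(gam w)
      = Complex.exp (-(∑ i ∈ s, (c i : ℂ) ^ 2) / 2) := by
  have h1 : ∀ i, ⇑(c i • gemb b (T (b i))) =ᵐ[gam w] fun x => c i * gemb b (T (b i)) x := fun i => by
    filter_upwards [Lp.coeFn_smul (c i) (gemb b (T (b i)))] with x h1
    rw [h1, Pi.smul_apply]; rfl
  have h0 : ⇑(∑ i ∈ s, c i • gemb b (T (b i)) : Lp ℝ 2 (gam w)) =ᵐ[gam w]
      fun x => ∑ i ∈ s, c i * gemb b (T (b i)) x := by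
    classical
    induction s using Finset.induction_on with
    | empty => 
      filter_upwards [Lp.coeFn_zero ℝ 2 (gam w)] with x hx
      simp only [Finset.sum_empty]; rw [hx]; rfl
    | insert a s ha ih =>
      rw [Finset.sum_insert ha]
      filter_upwards [Lp.coeFn_add (c a • gemb b (T (b a))) (∑ i ∈ s, c i • gemb b (T (b i))), ih, h1 a]
        with x a1 a2 a3
      rw [a1, Pi.add_apply, a2, a3, Finset.sum_insert ha]
  have e0 : ∫ x, uexp (∑ i ∈ s, c i * gemb b (T (b i)) x) ∂(gam w)
      = chf (∑ i ∈ s, c i • gemb b (T (b i))) := by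
    apply integral_congr_ae
    filter_upwards [h0] with x hx
    rw [hx]
  have e1 : ∑ i ∈ s, c i • gemb b (T (b i)) = gemb b (T (∑ i ∈ s, c i • b i)) := by
    simp only [map_sum, map_smul]
  have e2 : ‖T (∑ i ∈ s, c i • b i)‖ ^ 2 = ∑ i ∈ s, (c i) ^ 2 := by
    rw [LinearIsometry.norm_map, ← real_inner_self_eq_norm_sq, b.orthonormal.inner_sum]
    simp [pow_two]
  rw [e0, e1, chf_gemb]
  have e3 := congrArg (fun x : ℝ => (x : ℂ)) e2
  push_cast at e3
  rw [e3]

lemma quant_law (T : E →ₗᵢ[ℝ] E) (i : w) :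
    (gam w).map (fun x => gemb b (T (b i)) x) = gaussianReal 0 1 := by
  have : IsProbabilityMeasure ((gam w).map (fun x => gemb b (T (b i)) x)) :=
    Measure.isProbabilityMeasure_map (Lp2_meas _).aemeasurable
  apply Measure.ext_of_charFun
  ext t
  rw [charFun_uexp, integral_map (φ := fun x => gemb b (T (b i)) x) (Lp2_meas _).aemeasurable
    (show AEStronglyMeasurable (fun x => uexp (t * x)) _ from
      (measurable_uexp.comp (measurable_const_mul t)).aestronglyMeasurable), charFun_gaussianReal]
  have := gemb_sum b T {i} (fun _ => t)
  simp only [Finset.sum_singleton] at this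
  rw [this]
  congr 1; push_cast; ring

lemma quant_mp (T : E →ₗᵢ[ℝ] E) : MeasurePreserving (quant b T) (gam w) (gam w) := by
  refine ⟨measurable_quant b T, ?_⟩
  have hind : iIndepFun (fun i x => gemb b (T (b i)) x) (gam w) := by
    rw [iIndepFun_iff_finset]
    intro s
    have hX : ∀ i : s, AEMeasurable (s.restrict (fun i x => gemb b (T (b i)) x) i) (gam w) :=
      fun i => (Lp2_meas (gemb b (T (b i)))).aemeasurable
    rw [iIndepFun_iff_charFun_pi hX]
    intro t
    have hmm : Measurable (fun x => (WithLp.toLp 2 (fun i : s => gemb b (T (b i)) x))) :=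
      (WithLp.measurable_toLp 2 _).comp (measurable_pi_iff.mpr fun i => Lp2_meas _)
    have h1 : ∀ i : s, charFun ((gam w).map (s.restrict (fun i x => gemb b (T (b i)) x) i)) (t i)
        = Complex.exp (-((t i : ℂ) ^ 2) / 2) := by
      intro i
      have := quant_law b T i
      simp only [Finset.restrict]
      rw [this, charFun_gaussianReal]
      congr 1; push_cast; ring
    rw [Finset.prod_congr rfl fun i _ => h1 i, ← Complex.exp_sum, charFun_apply]
    classical
    have h2 := gemb_sum b T s (fun i => if h : i ∈ s then t ⟨i, h⟩ else 0)
    refine (integral_map (φ := fun x => (WithLp.toLp 2 (fun i : s => gemb b (T (b i)) x)))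
      hmm.aemeasurable ?_).trans ?_
    · exact Continuous.aestronglyMeasurable (by fun_prop)
    have h3 : ∀ x, ∑ i ∈ s, (if h : i ∈ s then t ⟨i, h⟩ else 0) * gemb b (T (b i)) x
        = ∑ i : s, t i * gemb b (T (b i)) x := by
      intro x
      rw [← Finset.sum_attach s]
      exact Finset.sum_congr rfl fun i _ => by simp
    have h4 : ∑ i ∈ s, (((if h : i ∈ s then t ⟨i, h⟩ else 0) : ℝ) : ℂ) ^ 2
        = ∑ i : s, (t i : ℂ) ^ 2 := by
      rw [← Finset.sum_attach s]
      exact Finset.sum_congr rfl fun i _ => by simp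
    rw [h4] at h2
    simp_rw [h3] at h2
    rw [← Finset.sum_div, Finset.sum_neg_distrib, ← h2]
    congr 1; ext x
    rw [uexp, mul_comm, PiLp.inner_apply]
    simp
  have := hind.map_fun_eq_infinitePi_map (fun i => Lp2_meas _)
  simp_rw [quant_law b T] at this
  exact this

lemma quant_comp (T : E →ₗᵢ[ℝ] E) (f : E) :
    gemb b f ∘ quant b T =ᵐ[gam w] gemb b (T f) := by
  let A : E →L[ℝ] Lp ℝ 2 (gam w) := ((Lp.compMeasurePreservingₗᵢ ℝ (quant b T) (quant_mp b T)).comp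
    (gemb b)).toContinuousLinearMap
  let B : E →L[ℝ] Lp ℝ 2 (gam w) := ((gemb b).comp T).toContinuousLinearMap
  have hAB : A = B := by
    refine ContinuousLinearMap.ext_on (b_dense b) ?_
    rintro _ ⟨i, rfl⟩
    show Lp.compMeasurePreserving (quant b T) (quant_mp b T) (gemb b (b i)) = gemb b (T (b i))
    apply Lp.ext
    refine (Lp.coeFn_compMeasurePreserving _ _).trans ?_
    rw [gemb_b]
    exact (quant_mp b T).quasiMeasurePreserving.ae_eq_comp (coor_coe i)
  have h1 : Lp.compMeasurePreserving (quant b T) (quant_mp b T) (gemb b f) = gemb b (T f) :=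
    congrArg (fun L => L f) hAB
  rw [← h1]
  exact (Lp.coeFn_compMeasurePreserving _ _).symm

end gauss2

open MeasureTheory ENNReal

lemma lintegral_two {X F : Type*} [MeasurableSpace X] [NormedAddCommGroup F] {μ : Measure X}
    (f : Lp F 2 μ) : ∫⁻ x, ‖f x‖ₑ ^ (2 : ℝ) ∂μ = ‖f‖ₑ ^ (2 : ℝ) := by
  have h := eLpNorm_nnreal_pow_eq_lintegral (f := f) (μ := μ) (p := 2) two_ne_zero
  rw [Lp.enorm_def]
  exact h.symm

lemma countable_hb {E : Type*} [NormedAddCommGroup E] [InnerProductSpace ℝ E]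
    [SecondCountableTopology E] {w : Type*} (b : HilbertBasis w ℝ E) : Countable w := by
  refine Pairwise.countable_of_isOpen_disjoint (s := fun i => Metric.ball (b i) (1 / 2)) ?_
    (fun i => Metric.isOpen_ball) (fun i => ⟨b i, Metric.mem_ball_self (by norm_num)⟩)
  intro i j hij
  apply Metric.ball_disjoint_ball
  rw [dist_eq_norm]
  have h := norm_sub_sq_real (b i) (b j)
  rw [b.orthonormal.2 hij, b.orthonormal.1 i, b.orthonormal.1 j] at h
  nlinarith [norm_nonneg (b i - b j)]

lemma gauss_L2 {X : Type*} [MeasurableSpace X] [StandardBorelSpace X] {μ : Measure X} [SigmaFinite μ]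
    {r : ℝ≥0∞} (hr : r = 2) : ∃ (w : Set (Lp ℂ r μ)) (_ : Countable w) (b : w → Lp ℂ r μ)
      (ι : Lp ℂ r μ → (w → ℝ) → ℝ), (∀ f, Measurable (ι f)) ∧
      (∀ f f', ι (f + f') =ᵐ[gam w] ι f + ι f') ∧
      (∀ (t : ℝ) f, ι (t • f) =ᵐ[gam w] fun x => t * ι f x) ∧
      (∀ i, ι (b i) =ᵐ[gam w] fun x => x i) ∧
      (∀ f, ∫⁻ x, ‖ι f x‖ₑ ^ (2 : ℝ) ∂(gam w) = NN μ 2 f) ∧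
      (IsEmpty w → ∀ f : Lp ℂ r μ, f = 0) ∧
      ∀ T : Lp ℂ r μ → Lp ℂ r μ, (∀ f g, T (f + g) = T f + T g) →
        (∀ (t : ℝ) f, T (t • f) = t • T f) → (∀ f, NN μ 2 (T f) = NN μ 2 f) →
        ∃ S, MeasurePreserving S (gam w) (gam w) ∧ ∀ f, ι f ∘ S =ᵐ[gam w] ι (T f) := by
  subst hr
  have : Fact ((2 : ℝ≥0∞) ≠ ⊤) := ⟨by simp⟩
  obtain ⟨w, b, hb⟩ := exists_hilbertBasis ℝ (Lp ℂ 2 μ)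
  have hNN : ∀ f : Lp ℂ 2 μ, NN μ 2 f = ‖f‖ₑ ^ (2 : ℝ) := fun f => lintegral_two f
  refine ⟨w, countable_hb b, b, fun f => gemb b f, fun f => Lp2_meas _, ?_, ?_, ?_, ?_, ?_, ?_⟩
  · intro f f'
    simp only [map_add]
    exact Lp.coeFn_add _ _
  · intro t f
    simp only [map_smul]
    filter_upwards [Lp.coeFn_smul t (gemb b f)] with x h1
    rw [h1]; rfl
  · intro i
    simp only [gemb_b]
    exact coor_coe i
  · intro f
    rw [hNN, lintegral_two]
    rw [← ofReal_norm, ← ofReal_norm, LinearIsometry.norm_map]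
  · intro hw f
    rw [← norm_eq_zero, ← b.repr.norm_map]
    have : b.repr f = 0 := by
      ext i; exact (IsEmpty.false i).elim
    rw [this, norm_zero]
  · intro T h1 h2 h3
    let T' : Lp ℂ 2 μ →ₗᵢ[ℝ] Lp ℂ 2 μ :=
      { toFun := T
        map_add' := h1
        map_smul' := h2
        norm_map' := fun f => by
          have h := h3 f
          rw [hNN, hNN] at h
          have h' := ENNReal.rpow_left_injective (two_ne_zero) h
          rw [← ofReal_norm, ← ofReal_norm] at h'
          exact (ENNReal.ofReal_eq_ofReal_iff (norm_nonneg _) (norm_nonneg _)).mp h' }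
    exact ⟨quant b T', quant_mp b T', fun f => quant_comp b T' f⟩

theorem final_two {G : Type*} [Group G] [TopologicalSpace G]
    {X : Type*} [MeasurableSpace X] {μ : Measure X} {q : ℝ} [StandardBorelSpace X] [SigmaFinite μ]
    (hpq : 2 < q) (α : AffineIsometricAction G μ 2) :
    ∃ (Y : Type) (_ : MeasurableSpace Y) (ν : Measure Y),
      StandardBorelSpace Y ∧ SigmaFinite ν ∧
      ∃ β : AffineIsometricAction G ν q,
        ∀ g : G, pPow μ 2 ((α.act g 0 : X →ₘ[μ] ℂ)) = pPow ν q ((β.act g 0 : Y →ₘ[ν] ℂ)) := by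
  obtain ⟨w, hw, b, ι, hm, hadd, hsmul, hb, hnorm, hemp, hT⟩ :=
    gauss_L2 (μ := μ) (r := ENNReal.ofReal 2) (by simp)
  rcases isEmpty_or_nonempty w with he | ⟨⟨i0⟩⟩
  · apply trivial_final
    intro g
    rw [hemp he (α.act g 0), pPow_eq_NN, NN_eq_zero (by norm_num) (Lp.aestronglyMeasurable _)]
    exact Lp.coeFn_zero _ _ _
  choose S hS hιS using fun g => hT (linPart α g) (linPart_add α g) (fun t f => linPart_smul α g t f)
    (linPart_linIso α g).iso
  have hc0 := c0_ne_zero 2 q (by norm_num) hpq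
  have hct := c0_ne_top 2 q (by norm_num) hpq
  have hz : ((gam w).prod (kap 2)) {y : (w → ℝ) × ℂ | y.2.re = 0} = 0 := by
    have : {y : (w → ℝ) × ℂ | y.2.re = 0} = Set.univ ×ˢ {z : ℂ | z.re = 0} := by ext y; simp
    rw [this, Measure.prod_prod, kap_re_zero, mul_zero]
  have hac : ((c0 2 q)⁻¹ • (gam w).prod (kap 2)) ≪ (gam w).prod (kap 2) :=
    Measure.smul_absolutelyContinuous
  have hz' : ((c0 2 q)⁻¹ • (gam w).prod (kap 2)) {y : (w → ℝ) × ℂ | y.2.re = 0} = 0 := hac hz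
  have hph : ∀ (k : (w → ℝ) → ℝ) y, ph (fun x => (k x : ℂ)) y = y.2.re * k y.1 := by
    intro k y; simp [ph]
  have hcongr : ∀ {k k' : (w → ℝ) → ℝ}, k =ᵐ[gam w] k' →
      ∀ᵐ y ∂((c0 2 q)⁻¹ • (gam w).prod (kap 2)), k y.1 = k' y.1 := fun h =>
    hac.ae_le (Measure.quasiMeasurePreserving_fst.ae h)
  have hsm : ∀ (n : ℕ) i,
      (fun y : (w → ℝ) × ℂ => uexp (y.2.re * ι (((n : ℝ) + 1)⁻¹ • b i) y.1))
      =ᵐ[(c0 2 q)⁻¹ • (gam w).prod (kap 2)]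
      fun y => uexp (((n : ℝ) + 1)⁻¹ * (y.2.re * y.1 i)) := by
    intro n i
    filter_upwards [hcongr (hsmul (((n : ℝ) + 1)⁻¹) (b i)), hcongr (hb i)] with y h1 h2
    rw [h1, h2]; congr 1; ring
  have hre : Measurable (fun y : (w → ℝ) × ℂ => y.2.re) := Complex.measurable_re.comp measurable_snd
  have hΨm : ∀ f, Measurable (fun y : (w → ℝ) × ℂ => uexp (y.2.re * ι f y.1)) := fun f =>
    measurable_uexp.comp (hre.mul ((hm f).comp measurable_fst))
  have hi : ∀ i, Measurable (fun y : (w → ℝ) × ℂ => y.1 i) := fun i =>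
    (measurable_pi_apply i).comp measurable_fst
  have hum : ∀ (n : ℕ) i, Measurable
      (fun y : (w → ℝ) × ℂ => uexp (((n : ℝ) + 1)⁻¹ * (y.2.re * y.1 i))) := fun n i =>
    measurable_uexp.comp ((hre.mul (hi i)).const_mul _)
  have M : Model α q ((c0 2 q)⁻¹ • (gam w).prod (kap 2)) (fun f y => uexp (y.2.re * ι f y.1))
      (fun g y => (S g y.1, y.2)) := by
    constructor
    · exact hΨm
    · exact fun f y => uexp_norm _
    · intro f f'
      filter_upwards [hcongr (hadd f f')] with y hy
      rw [hy, Pi.mul_apply, ← uexp_add, Pi.add_apply, mul_add]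
    · intro f
      unfold NN
      rw [lintegral_smul_measure, lintegral_prod]
      · have : ∀ x, ∫⁻ ξ, ‖((fun y : (w → ℝ) × ℂ => uexp (y.2.re * ι f y.1)) - 1 :
            (w → ℝ) × ℂ → ℂ) (x, ξ)‖ₑ ^ q ∂(kap 2) = ‖ι f x‖ₑ ^ (2 : ℝ) * c0 2 q := fun x => by
          have := lintegral_uexp_kap 2 q (by norm_num) hpq (ι f x : ℂ)
          have he : ‖((ι f x : ℝ) : ℂ)‖ₑ = ‖ι f x‖ₑ := by
            rw [← ofReal_norm, ← ofReal_norm, Complex.norm_real]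
          rw [he] at this
          rw [← this]
          apply lintegral_congr
          intro ξ
          simp
        simp_rw [this]
        rw [lintegral_mul_const _ (by have := hm f; fun_prop), hnorm, smul_eq_mul, mul_comm, mul_assoc,
          ENNReal.mul_inv_cancel hc0 hct, mul_one]
        rfl
      · exact (((hΨm f).sub measurable_one).enorm.pow_const q).aemeasurable
    · intro g
      exact ((hS g).prod (MeasurePreserving.id (kap 2))).smul_measure _
    · intro g f
      filter_upwards [hcongr (hιS g f)] with y hy
      simp only [Function.comp] at hy ⊢
      rw [hy]
    · intro m hle hN hinv hF
      have hsnd : Measurable[m] (Prod.snd : (w → ℝ) × ℂ → ℂ) := fun C hC =>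
        hinv _ (measurable_snd hC) fun g => rfl
      have hre' : Measurable[m] (fun y : (w → ℝ) × ℂ => y.2.re) := Complex.measurable_re.comp hsnd
      have hu : ∀ i, Measurable[m] (fun y : (w → ℝ) × ℂ => y.2.re * y.1 i) := by
        intro i
        refine measurable_of_uexp m fun n => hF _ _ ?_ (hsm n i).symm
        exact hum n i
      have hfst : Measurable[m] (Prod.fst : (w → ℝ) × ℂ → (w → ℝ)) := by
        refine measurable_pi_iff.mpr fun i => ?_
        intro C hC
        have e1 : ((fun y : (w → ℝ) × ℂ => y.1 i) ⁻¹' C) =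
            ((fun y : (w → ℝ) × ℂ => (y.2.re * y.1 i) / y.2.re) ⁻¹' C ∩ {y | y.2.re ≠ 0}) ∪
            (((fun y : (w → ℝ) × ℂ => y.1 i) ⁻¹' C) ∩ {y : (w → ℝ) × ℂ | y.2.re = 0}) := by
          ext ⟨x, ξ⟩
          by_cases hxi : ξ.re = 0 <;> simp [hxi]
        have hd := ((hu i).div hre') hC
        have hd2 := hre' (measurableSet_singleton 0).compl
        have hd3 := hN _ ((hi i hC).inter (hre (measurableSet_singleton 0)))
          (measure_mono_null Set.inter_subset_right hz')
        rw [e1]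
        exact (hd.inter hd2).union hd3
      exact sup_le (measurable_iff_comap_le.mp hfst) (measurable_iff_comap_le.mp hsnd)
    · refine ⟨fun n => ((n : ℝ) + 1)⁻¹ • b i0, ?_⟩
      have hz2 : ∀ᵐ y ∂((c0 2 q)⁻¹ • (gam w).prod (kap 2)), ¬ (y.2.re = 0) := by
        rw [ae_iff]; simpa using hz'
      have hz3 : ∀ᵐ y ∂((c0 2 q)⁻¹ • (gam w).prod (kap 2)), y.1 i0 ≠ 0 := by
        have h : ∀ᵐ x ∂(gam w), x i0 ≠ 0 := by
          refine (gam_mp i0).quasiMeasurePreserving.ae (p := fun t => t ≠ 0) ?_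
          have := ProbabilityTheory.nullSingletonClass_gaussianReal (μ := 0) (v := 1) one_ne_zero
          rw [ae_iff]; simp
        have h2 : ∀ᵐ y ∂((gam w).prod (kap 2)), y.1 i0 ≠ 0 :=
          Measure.quasiMeasurePreserving_fst.ae h
        exact hac.ae_le h2
      filter_upwards [hz2, hz3, ae_all_iff.mpr fun n => hsm n i0] with y h1 h2 h3
      simp only [h3]
      exact uexp_ne (mul_ne_zero h1 h2)
  have hσ : SigmaFinite ((c0 2 q)⁻¹ • (gam w).prod (kap 2)) := by
    lift (c0 2 q)⁻¹ to NNReal using (ENNReal.inv_ne_top.mpr hc0) with c hc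
    exact SMul.sigmaFinite c
  exact M.final (by norm_num) (by linarith)

theorem final_ne {G : Type*} [Group G] [TopologicalSpace G]
    {X : Type*} [MeasurableSpace X] {μ : Measure X} {p q : ℝ} [StandardBorelSpace X] [SigmaFinite μ]
    (hp : 0 < p) (hpq : p < q) (hp2 : p ≠ 2) (α : AffineIsometricAction G μ p) :
    ∃ (Y : Type) (_ : MeasurableSpace Y) (ν : Measure Y),
      StandardBorelSpace Y ∧ SigmaFinite ν ∧
      ∃ β : AffineIsometricAction G ν q,
        ∀ g : G, pPow μ p ((α.act g 0 : X →ₘ[μ] ℂ)) = pPow ν q ((β.act g 0 : Y →ₘ[ν] ℂ)) := by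
  rcases isEmpty_or_nonempty X with he | hne
  · apply trivial_final
    intro g
    rw [pPow, lintegral_of_isEmpty]
  obtain ⟨S, M⟩ := model_ne_two hp hpq hp2 α
  have hσ : SigmaFinite ((c0 p q)⁻¹ • μ.prod (kap p)) := by
    lift (c0 p q)⁻¹ to NNReal using (ENNReal.inv_ne_top.mpr (c0_ne_zero p q hp hpq)) with c hc
    exact SMul.sigmaFinite c
  exact M.final hp (hp.trans hpq)

/-- **Theorem A.** Let `G` be a topological group and `0 < p < q < ∞`.  For every
continuous affine isometric action `α` of `G` on an `L_p` space `L_p(X,μ)` (with `(X,μ)`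
a standard σ-finite measure space), there is a continuous affine isometric action `β` of
`G` on an `L_q` space `L_q(Y,ν)` such that `‖α_g(0)‖_p^p = ‖β_g(0)‖_q^q` for all `g`. -/
theorem stmt0 {G : Type*} [Group G] [TopologicalSpace G] [IsTopologicalGroup G]
    {X : Type*} [MeasurableSpace X] [StandardBorelSpace X]
    (μ : Measure X) [SigmaFinite μ]
    {p q : ℝ} (hp : 0 < p) (hpq : p < q)
    (α : AffineIsometricAction G μ p) :
    ∃ (Y : Type) (_ : MeasurableSpace Y) (ν : Measure Y),
      StandardBorelSpace Y ∧ SigmaFinite ν ∧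
      ∃ β : AffineIsometricAction G ν q,
        ∀ g : G, pPow μ p ((α.act g 0 : X →ₘ[μ] ℂ)) = pPow ν q ((β.act g 0 : Y →ₘ[ν] ℂ)) := by
  by_cases h2 : p = 2
  · subst h2
    exact final_two hpq α
  · exact final_ne hp hpq h2 α
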